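/- arXiv:2003.00727 — 6 statements merged into one kernel-verified Lean document; each statement's English description precedes it below -/
import Mathlib

section
/- Let Z be a Brown–Resnick stationary random field with values in E satisfying E[Z(t)] = 1 for all t ∈ ℤ^d, max_{t∈ℤ^d} Z(t) > 0 almost surely, and P(Σ_{t∈ℤ^d} Z(t) < ∞) > 0; let Θ be its spectral tail field, R a unit Pareto random variable independent of Θ, and Y = R·Θ. Then the classical extremal index H_Z = lim_{n→∞} n^{−d} E[max_{t∈{0,…,n}^d} Z(t)] satisfies H_Z = P(I_fm(Θ) = 0) = P(I_fe(Y) = 0). -/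
open MeasureTheory ENNReal Filter
open scoped NNReal ENNReal

/-- Index set `ℤ^d`. -/
abbrev Idx (d : ℕ) := Fin d → ℤ

/-- The space `E = [0,∞)^{ℤ^d}` (with the product σ-field). -/
abbrev Fld (d : ℕ) := Idx d → ℝ≥0

/-- The shift `B^h`, acting by `(B^h f)(t) = f (t - h)`. -/
def shift {d : ℕ} (h : Idx d) (f : Fld d) : Fld d := fun t => f (t - h)

/-- `F : E → [0,∞]` is 0-homogeneous if `F (c • f) = F f` for all `c > 0`. -/
def Homog0 {d : ℕ} (F : Fld d → ℝ≥0∞) : Prop :=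
  ∀ c : ℝ≥0, 0 < c → ∀ f : Fld d, F (fun t => c * f t) = F f

/-- `Z` is a Brown–Resnick stationary random field with unit means: it is measurable,
`E[Z(t)] = 1` for all `t`, and `E[Z(h) F(Z)] = E[Z(0) F(B^h Z)]` for every measurable
0-homogeneous `F : E → [0,∞]`. -/
structure IsBRS {d : ℕ} {Ω : Type*} [MeasurableSpace Ω] (P : Measure Ω)
    (Z : Ω → Fld d) : Prop where
  meas : Measurable Z
  mean_one : ∀ t : Idx d, ∫⁻ ω, (Z ω t : ℝ≥0∞) ∂P = 1
  tilt_shift : ∀ (h : Idx d) (F : Fld d → ℝ≥0∞), Measurable F → Homog0 F →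
    ∫⁻ ω, (Z ω h : ℝ≥0∞) * F (Z ω) ∂P = ∫⁻ ω, (Z ω 0 : ℝ≥0∞) * F (shift h (Z ω)) ∂P

/-- The discrete cube `{0,1,…,n}^d ⊆ ℤ^d`. -/
def cube (d n : ℕ) : Set (Idx d) := {t | ∀ j, 0 ≤ t j ∧ t j ≤ (n : ℤ)}

/-- `E[max_{t ∈ {0,…,n}^d} Z(t)]`. -/
noncomputable def cubeMaxExp {d : ℕ} {Ω : Type*} [MeasurableSpace Ω] (P : Measure Ω)
    (Z : Ω → Fld d) (n : ℕ) : ℝ≥0∞ :=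
  ∫⁻ ω, ⨆ t ∈ cube d n, (Z ω t : ℝ≥0∞) ∂P

/-- The spectral tail field: `Θ` (on a possibly different probability space `Q`) has law
`P(Θ ∈ A) = E[Z(0)·1{Z/Z(0) ∈ A}]` (the integrand vanishing on `{Z(0) = 0}`). -/
def IsSpectralTail {d : ℕ} {Ω Ω' : Type*} [MeasurableSpace Ω] [MeasurableSpace Ω']
    (P : Measure Ω) (Z : Ω → Fld d) (Q : Measure Ω') (Θ : Ω' → Fld d) : Prop :=
  Measurable Θ ∧ ∀ A : Set (Fld d), MeasurableSet A →
    Q (Θ ⁻¹' A) =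
      ∫⁻ ω, (Z ω 0 : ℝ≥0∞) *
        A.indicator (fun _ => (1 : ℝ≥0∞)) (fun t => Z ω t / Z ω 0) ∂P

/-- `R` is a unit Pareto random variable: `P(R > x) = 1/x` for `x ≥ 1`. -/
def IsUnitPareto {Ω : Type*} [MeasurableSpace Ω] (P : Measure Ω) (R : Ω → ℝ≥0) : Prop :=
  Measurable R ∧ ∀ x : ℝ, 1 ≤ x → P {ω | x < (R ω : ℝ)} = ENNReal.ofReal x⁻¹

/-- Lexicographic order on `ℤ^d`. -/
def lexLe {d : ℕ} (a b : Idx d) : Prop :=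
  a = b ∨ ∃ j, (∀ k, k < j → a k = b k) ∧ a j < b j

/-- `I_fm(f) = 0`: `f` lies in the domain `{S(f) < ∞, max_t f(t) > 0}` and `0` is the
first (lexicographic) maximizer of `f`. -/
def FirstMaxAtZero {d : ℕ} (f : Fld d) : Prop :=
  (∑' t : Idx d, (f t : ℝ≥0∞)) < ∞ ∧ (∃ t, 0 < f t) ∧
  (∀ t, f t ≤ f 0) ∧ ∀ j, (∀ t, f t ≤ f j) → lexLe 0 j

/-- `I_fe(f) = 0`: `f` lies in the domain `{S(f) < ∞, max_t f(t) > 1}` and `0` is the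
first (lexicographic) point where `f` exceeds `1`. -/
def FirstExcAtZero {d : ℕ} (f : Fld d) : Prop :=
  (∑' t : Idx d, (f t : ℝ≥0∞)) < ∞ ∧ (∃ t, 1 < f t) ∧
  1 < f 0 ∧ ∀ j, 1 < f j → lexLe 0 j


/-- strict lexicographic order -/
def lxLt {d : ℕ} (a b : Idx d) : Prop := toLex a < toLex b

lemma lxLt_iff {d : ℕ} (a b : Idx d) : lxLt a b ↔ ∃ j, (∀ k, k < j → a k = b k) ∧ a j < b j :=
  Iff.rfl

lemma lexLe_iff {d : ℕ} (a b : Idx d) : lexLe a b ↔ ¬ lxLt b a := by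
  have : lexLe a b ↔ toLex a ≤ toLex b := by
    rw [le_iff_eq_or_lt]
    unfold lexLe
    rw [← lxLt_iff]
    rfl
  rw [this]
  exact not_lt.symm

lemma lxLt_add {d : ℕ} (a b t : Idx d) : lxLt (a + t) (b + t) ↔ lxLt a b := by
  simp [lxLt_iff]

lemma lxLt_trichotomy {d : ℕ} (a b : Idx d) : lxLt a b ∨ a = b ∨ lxLt b a :=
  lt_trichotomy (toLex a) (toLex b)

/-- sum functional -/
noncomputable def SS {d : ℕ} (f : Fld d) : ℝ≥0∞ := ∑' t : Idx d, (f t : ℝ≥0∞)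

/-- `0` is the first maximum over the window `A`. -/
def FM {d : ℕ} (A : Set (Idx d)) (f : Fld d) : Prop :=
  ∀ s ∈ A, f s ≤ f 0 ∧ (lxLt s 0 → f s < f 0)

open Classical in
/-- indicator of `FM`. -/
noncomputable def fm {d : ℕ} (A : Set (Idx d)) (f : Fld d) : ℝ≥0∞ := if FM A f then 1 else 0

/-- relative record increment at `0` over window `A`. -/
noncomputable def fe {d : ℕ} (A : Set (Idx d)) (f : Fld d) : ℝ≥0∞ :=
  ((f 0 : ℝ≥0∞) - ⨆ s : {s : Idx d // s ∈ A ∧ lxLt s 0}, (f s : ℝ≥0∞)) / (f 0 : ℝ≥0∞)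

open Classical in
/-- indicator of finite sum -/
noncomputable def wS {d : ℕ} (f : Fld d) : ℝ≥0∞ := if SS f < ∞ then 1 else 0

/-- finset cube -/
noncomputable def cubeF (d n : ℕ) : Finset (Idx d) := Fintype.piFinset (fun _ => Finset.Icc (0:ℤ) n)

lemma mem_cubeF {d n : ℕ} (t : Idx d) : t ∈ cubeF d n ↔ t ∈ cube d n := by
  simp [cubeF, cube]

/-- symmetric box -/
def box (d m : ℕ) : Set (Idx d) := {t | ∀ j, -(m:ℤ) ≤ t j ∧ t j ≤ (m:ℤ)}

/-- translated window -/
def win {d : ℕ} (A : Set (Idx d)) (t : Idx d) : Set (Idx d) := {s | s + t ∈ A}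

lemma measurable_SS {d : ℕ} : Measurable (SS (d := d)) := by
  unfold SS; fun_prop

lemma measurableSet_FM {d : ℕ} (A : Set (Idx d)) : MeasurableSet {f : Fld d | FM A f} := by
  unfold FM
  simp only [Set.ofPred_forall]
  refine MeasurableSet.iInter fun s => MeasurableSet.iInter fun _ => ?_
  refine MeasurableSet.inter ?_ ?_
  · exact measurableSet_le (by fun_prop) (by fun_prop)
  · by_cases h : lxLt s 0
    · simp only [h, true_imp_iff]
      exact measurableSet_lt (by fun_prop) (by fun_prop)
    · simp only [h, false_imp_iff]
      exact MeasurableSet.univ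

lemma measurable_fm {d : ℕ} (A : Set (Idx d)) : Measurable (fm A) :=
  Measurable.ite (measurableSet_FM A) measurable_const measurable_const

lemma measurable_fe {d : ℕ} (A : Set (Idx d)) : Measurable (fe A) := by
  unfold fe
  refine Measurable.div (Measurable.sub (by fun_prop) (Measurable.iSup fun s => by fun_prop)) (by fun_prop)

lemma measurable_wS {d : ℕ} : Measurable (wS (d := d)) :=
  Measurable.ite (measurableSet_lt measurable_SS measurable_const) measurable_const measurable_const

lemma SS_smul {d : ℕ} (c : ℝ≥0) (f : Fld d) : SS (fun t => c * f t) = c * SS f := by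
  simp [SS, ENNReal.tsum_mul_left]

lemma SS_shift {d : ℕ} (h : Idx d) (f : Fld d) : SS (shift h f) = SS f := by
  unfold SS shift
  exact (Equiv.subRight h).tsum_eq (fun t => (f t : ℝ≥0∞))

lemma homog_wS {d : ℕ} : Homog0 (wS (d := d)) := by
  intro c hc f
  unfold wS
  rw [SS_smul]
  have : ((c : ℝ≥0∞) * SS f < ∞) ↔ SS f < ∞ := by
    rw [ENNReal.mul_lt_top_iff]
    simp [hc.ne']
    rintro h; simp [h]
  simp only [this]

lemma FM_smul {d : ℕ} (A : Set (Idx d)) (c : ℝ≥0) (hc : 0 < c) (f : Fld d) :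
    FM A (fun t => c * f t) ↔ FM A f := by
  unfold FM
  simp [mul_le_mul_iff_right₀ hc, mul_lt_mul_iff_right₀ hc]

lemma homog_fm {d : ℕ} (A : Set (Idx d)) : Homog0 (fm A) := by
  intro c hc f
  unfold fm
  classical exact if_congr (FM_smul A c hc f) rfl rfl

lemma homog_fe {d : ℕ} (A : Set (Idx d)) : Homog0 (fe A) := by
  intro c hc f
  unfold fe
  have hc' : (c : ℝ≥0∞) ≠ 0 := by simpa using hc.ne'
  simp only [ENNReal.coe_mul]
  rw [← ENNReal.mul_iSup, ← ENNReal.mul_sub (fun _ _ => ENNReal.coe_ne_top),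
    ENNReal.mul_div_mul_left _ _ hc' ENNReal.coe_ne_top]

lemma fm_le_one {d : ℕ} (A : Set (Idx d)) (f : Fld d) : fm A f ≤ 1 := by
  unfold fm; split_ifs <;> simp

lemma wS_le_one {d : ℕ} (f : Fld d) : wS f ≤ 1 := by
  unfold wS; split_ifs <;> simp

lemma fe_le_one {d : ℕ} (A : Set (Idx d)) (f : Fld d) : fe A f ≤ 1 := by
  unfold fe
  exact (ENNReal.div_le_div_right tsub_le_self _).trans ENNReal.div_self_le_one

lemma fm_anti {d : ℕ} {A B : Set (Idx d)} (h : A ⊆ B) (f : Fld d) : fm B f ≤ fm A f := by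
  unfold fm
  by_cases h1 : FM B f
  · have : FM A f := fun s hs => h1 s (h hs)
    simp [h1, this]
  · simp [h1]

lemma fe_anti {d : ℕ} {A B : Set (Idx d)} (h : A ⊆ B) (f : Fld d) : fe B f ≤ fe A f := by
  unfold fe
  refine ENNReal.div_le_div_right (tsub_le_tsub_left ?_ _) _
  refine iSup_le fun s => ?_
  exact le_iSup (fun s : {s : Idx d // s ∈ B ∧ lxLt s 0} => (f s : ℝ≥0∞)) ⟨s.1, h s.2.1, s.2.2⟩

lemma mem_box {d : ℕ} (s : Idx d) : ∃ m₀ : ℕ, ∀ m, m₀ ≤ m → s ∈ box d m := by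
  refine ⟨∑ j, (s j).natAbs, fun m hm j => ?_⟩
  have := Finset.single_le_sum (f := fun j => (s j).natAbs) (fun _ _ => Nat.zero_le _) (Finset.mem_univ j)
  omega

lemma box_mono {d : ℕ} {m n : ℕ} (h : m ≤ n) : box d m ⊆ box d n := by
  intro s hs j
  have := hs j
  omega

lemma fm_tendsto {d : ℕ} (f : Fld d) :
    Tendsto (fun m => fm (box d m) f) atTop (nhds (fm Set.univ f)) := by
  by_cases h : FM Set.univ f
  · have : ∀ m, fm (box d m) f = fm Set.univ f := by
      intro m
      have : FM (box d m) f := fun s _ => h s trivial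
      simp [fm, h, this]
    simp only [this]
    exact tendsto_const_nhds
  · have h2 := h
    unfold FM at h2
    push Not at h2
    obtain ⟨s, -, hs⟩ := h2
    obtain ⟨m₀, hm⟩ := mem_box s
    refine tendsto_const_nhds.congr' ?_
    filter_upwards [eventually_ge_atTop m₀] with m hmm
    have : ¬ FM (box d m) f := by
      intro h3
      have h4 := h3 s (hm m hmm)
      obtain ⟨h5, h6⟩ := hs h4.1
      exact absurd (h4.2 h5) (not_lt.2 h6)
    simp [fm, h, this]

lemma fe_tendsto {d : ℕ} (f : Fld d) :
    Tendsto (fun m => fe (box d m) f) atTop (nhds (fe Set.univ f)) := by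
  by_cases h0 : f 0 = 0
  · simp [fe, h0]
  unfold fe
  refine ENNReal.Tendsto.div_const (ENNReal.Tendsto.sub tendsto_const_nhds ?_ (Or.inl ENNReal.coe_ne_top))
    (Or.inr (by simpa using h0))
  have hm : Monotone (fun m => ⨆ s : {s : Idx d // s ∈ box d m ∧ lxLt s 0}, (f s : ℝ≥0∞)) := by
    intro m n hmn
    refine iSup_le fun s => ?_
    exact le_iSup (fun s : {s : Idx d // s ∈ box d n ∧ lxLt s 0} => (f s : ℝ≥0∞))
      ⟨s.1, box_mono hmn s.2.1, s.2.2⟩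
  convert tendsto_atTop_iSup hm using 2
  apply le_antisymm
  · refine iSup_le fun s => ?_
    obtain ⟨m₀, hm⟩ := mem_box s.1
    exact le_iSup_of_le m₀ (le_iSup (fun s : {s : Idx d // s ∈ box d m₀ ∧ lxLt s 0} => (f s : ℝ≥0∞))
      ⟨s.1, hm _ le_rfl, s.2.2⟩)
  · refine iSup_le fun m => iSup_le fun s => ?_
    exact le_iSup (fun s : {s : Idx d // s ∈ Set.univ ∧ lxLt s 0} => (f s : ℝ≥0∞)) ⟨s.1, trivial, s.2.2⟩

lemma FM_win {d : ℕ} (A : Set (Idx d)) (t : Idx d) (f : Fld d) :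
    FM (win A t) (shift (-t) f) ↔ ∀ u ∈ A, f u ≤ f t ∧ (lxLt u t → f u < f t) := by
  unfold FM win shift
  simp only [Set.mem_ofPred_eq, sub_neg_eq_add, zero_add]
  constructor
  · intro h u hu
    have := h (u - t) (by simpa using hu)
    rwa [sub_add_cancel, ← lxLt_add _ _ t, sub_add_cancel, zero_add] at this
  · intro h s hs
    have := h _ hs
    refine ⟨this.1, fun h1 => this.2 ?_⟩
    rw [← lxLt_add _ _ t, zero_add] at h1
    exact h1

lemma fe_win {d : ℕ} (A : Set (Idx d)) (t : Idx d) (f : Fld d) :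
    (f t : ℝ≥0∞) * fe (win A t) (shift (-t) f) =
      (f t : ℝ≥0∞) - ⨆ u : {u : Idx d // u ∈ A ∧ lxLt u t}, (f u : ℝ≥0∞) := by
  have h1 : (⨆ s : {s : Idx d // s ∈ win A t ∧ lxLt s 0}, (shift (-t) f s : ℝ≥0∞)) =
      ⨆ u : {u : Idx d // u ∈ A ∧ lxLt u t}, (f u : ℝ≥0∞) := by
    apply le_antisymm
    · refine iSup_le fun s => ?_
      have h2 := s.2.2
      rw [← lxLt_add _ _ t, zero_add] at h2
      refine le_trans (le_of_eq ?_) (le_iSup (fun u : {u : Idx d // u ∈ A ∧ lxLt u t} => (f u : ℝ≥0∞))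
        ⟨s.1 + t, s.2.1, h2⟩)
      simp [shift]
    · refine iSup_le fun s => ?_
      have h2 := s.2.2
      refine le_trans (le_of_eq ?_) (le_iSup (fun s : {s : Idx d // s ∈ win A t ∧ lxLt s 0} => (shift (-t) f s : ℝ≥0∞))
        ⟨s.1 - t, by simpa [win] using s.2.1, by
          rw [← lxLt_add _ _ t, zero_add, sub_add_cancel]; exact h2⟩)
      simp [shift]
  unfold fe
  rw [h1]
  have : shift (-t) f 0 = f t := by simp [shift]
  rw [this]
  by_cases h0 : f t = 0
  · simp [h0]
  · exact ENNReal.mul_div_cancel (by simpa using h0) ENNReal.coe_ne_top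

lemma fm_sum {d : ℕ} (C : Finset (Idx d)) (f : Fld d) :
    ∑ t ∈ C, (f t : ℝ≥0∞) * fm (win C t) (shift (-t) f) = ⨆ t ∈ C, (f t : ℝ≥0∞) := by
  rcases C.eq_empty_or_nonempty with rfl | hC
  · simp
  -- the first maximum
  obtain ⟨a, ha, hmax⟩ := C.exists_max_image f hC
  have hC2 : (C.filter (fun t => f t = f a)).Nonempty := ⟨a, by simp [ha]⟩
  obtain ⟨b, hb, hmin⟩ := (C.filter (fun t => f t = f a)).exists_min_image (fun t => toLex t) hC2
  rw [Finset.mem_filter] at hb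
  have hbF : FM (win C b) (shift (-b) f) := by
    rw [FM_win]
    intro u hu
    have hu' : u ∈ C := by simpa using hu
    rw [hb.2]
    refine ⟨hmax u hu', fun hlt => lt_of_le_of_ne (hmax u hu') fun he => ?_⟩
    have := hmin u (by simp [hu', he])
    exact absurd hlt (not_lt.2 this)
  rw [Finset.sum_eq_single b]
  · have : fm (win C b) (shift (-b) f) = 1 := by simp [fm, hbF]
    rw [this, mul_one]
    apply le_antisymm
    · exact le_iSup₂ (f := fun t (_ : t ∈ C) => (f t : ℝ≥0∞)) b hb.1
    · refine iSup₂_le fun t ht => ?_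
      rw [hb.2]
      exact_mod_cast hmax t ht
  · intro t ht htb
    have : ¬ FM (win C t) (shift (-t) f) := by
      intro h
      rw [FM_win] at h hbF
      have h1 := h b (by simpa using hb.1)
      have h2 := hbF t (by simpa using ht)
      rcases lxLt_trichotomy b t with h3 | h3 | h3
      · exact absurd (h1.2 h3) (not_lt.2 h2.1)
      · exact htb h3.symm
      · exact absurd (h2.2 h3) (not_lt.2 h1.1)
    simp [fm, this]
  · intro h; exact absurd hb.1 h

lemma fe_sum_aux {α : Type*} [LinearOrder α] (C : Finset α) (f : α → ℝ≥0∞) :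
    ∑ t ∈ C, (f t - ⨆ u ∈ C, ⨆ (_ : u < t), f u) = ⨆ t ∈ C, f t := by
  induction C using Finset.induction_on_max with
  | empty => simp
  | insert a s has ih =>
    have hna : a ∉ s := fun h => lt_irrefl _ (has a h)
    have h1 : ∑ t ∈ s, (f t - ⨆ u ∈ insert a s, ⨆ (_ : u < t), f u)
        = ∑ t ∈ s, (f t - ⨆ u ∈ s, ⨆ (_ : u < t), f u) := by
      refine Finset.sum_congr rfl fun t ht => ?_
      rw [Finset.iSup_insert]
      have : ¬ a < t := not_lt.2 (has t ht).le
      simp [this]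
    have h2 : (⨆ u ∈ insert a s, ⨆ (_ : u < a), f u) = ⨆ u ∈ s, f u := by
      rw [Finset.iSup_insert]
      simp only [lt_irrefl, iSup_false, bot_sup_eq]
      refine iSup_congr fun u => iSup_congr fun hu => ?_
      simp [has u hu]
    rw [Finset.sum_insert hna, h1, h2, ih, Finset.iSup_insert]
    exact tsub_add_eq_max

lemma fe_sum {d : ℕ} (C : Finset (Idx d)) (f : Fld d) :
    ∑ t ∈ C, (f t : ℝ≥0∞) * fe (win C t) (shift (-t) f) = ⨆ t ∈ C, (f t : ℝ≥0∞) := by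
  simp only [fe_win]
  have := fe_sum_aux (α := Lex (Idx d)) (C.map toLex.toEmbedding) (fun t => (f (ofLex t) : ℝ≥0∞))
  simp only [Finset.sum_map] at this
  simp only [iSup_subtype, iSup_and]
  convert this using 1
  · refine Finset.sum_congr rfl fun t ht => ?_
    congr 1
    refine (Equiv.iSup_congr toLex fun u => ?_)
    have h : toLex u ∈ C.map toLex.toEmbedding ↔ u ∈ C := by simp
    simp only [h, ofLex_toLex, Finset.mem_coe]
    rfl
  · refine (Equiv.iSup_congr toLex fun u => ?_)
    simp

lemma ratio_tendsto (k : ℕ) :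
    Tendsto (fun n : ℕ => ((n + 1 - k : ℕ) : ℝ≥0∞) / (n : ℝ≥0∞)) atTop (nhds 1) := by
  have h1 : Tendsto (fun n : ℕ => 1 + (1 - (k:ℝ)) / (n : ℝ)) atTop (nhds (1 + 0)) :=
    tendsto_const_nhds.add (tendsto_const_div_atTop_nhds_zero_nat _)
  have h2 := (ENNReal.continuous_ofReal.tendsto _).comp h1
  simp only [add_zero, ENNReal.ofReal_one] at h2
  refine h2.congr' ?_
  filter_upwards [eventually_ge_atTop (k+1)] with n hn
  have hn0 : (0:ℝ) < n := by exact_mod_cast (by omega : 0 < n)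
  have : (1 + (1 - (k:ℝ)) / (n : ℝ)) = ((n + 1 - k : ℕ) : ℝ) / (n : ℝ) := by
    rw [Nat.cast_sub (by omega)]
    push_cast
    field_simp
    ring
  simp only [Function.comp]
  rw [this, ENNReal.ofReal_div_of_pos hn0, ENNReal.ofReal_natCast, ENNReal.ofReal_natCast]

lemma ratio_pow_tendsto (k d : ℕ) :
    Tendsto (fun n : ℕ => (((n + 1 - k) ^ d : ℕ) : ℝ≥0∞) / (n : ℝ≥0∞) ^ d) atTop (nhds 1) := by
  have := ENNReal.Tendsto.pow (n := d) (ratio_tendsto k)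
  rw [one_pow] at this
  refine this.congr fun n => ?_
  rw [div_eq_mul_inv, mul_pow, ← ENNReal.inv_pow, ← div_eq_mul_inv, Nat.cast_pow]

/-- inner cube -/
noncomputable def innF (d n m : ℕ) : Finset (Idx d) :=
  Fintype.piFinset (fun _ => Finset.Icc (m:ℤ) ((n:ℤ) - m))

lemma card_cubeF (d n : ℕ) : (cubeF d n).card = (n + 1 - 0) ^ d := by
  unfold cubeF
  rw [Fintype.card_piFinset_const]
  simp

lemma card_innF (d n m : ℕ) : (innF d n m).card = (n + 1 - 2 * m) ^ d := by
  unfold innF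
  rw [Fintype.card_piFinset_const]
  rw [Int.card_Icc]
  congr 1
  omega

lemma innF_sub (d n m : ℕ) : innF d n m ⊆ cubeF d n := by
  intro t ht
  simp only [innF, cubeF, Fintype.mem_piFinset, Finset.mem_Icc] at ht ⊢
  intro j
  have := ht j
  omega

lemma box_sub_win {d n m : ℕ} {t : Idx d} (ht : t ∈ innF d n m) :
    box d m ⊆ win (cubeF d n : Set (Idx d)) t := by
  intro s hs
  simp only [win, Set.mem_ofPred_eq, Finset.mem_coe, innF, cubeF, Fintype.mem_piFinset,
    Finset.mem_Icc, box, Pi.add_apply] at ht hs ⊢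
  intro j
  have := ht j
  have := hs j
  omega

lemma count_tendsto {d : ℕ} (φ : Set (Idx d) → ℝ≥0∞) (h1 : ∀ A, φ A ≤ 1)
    (anti : ∀ A B, A ⊆ B → φ B ≤ φ A)
    (lim : Tendsto (fun m => φ (box d m)) atTop (nhds (φ Set.univ))) :
    Tendsto (fun n : ℕ => (∑ t ∈ cubeF d n, φ (win (cubeF d n : Set (Idx d)) t)) / (n : ℝ≥0∞) ^ d)
      atTop (nhds (φ Set.univ)) := by
  classical
  have hc := ratio_pow_tendsto 0 d
  refine tendsto_of_le_liminf_of_limsup_le ?_ ?_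
  · have hl : Tendsto (fun n : ℕ => (((n + 1 - 0) ^ d : ℕ) : ℝ≥0∞) / (n : ℝ≥0∞) ^ d * φ Set.univ) atTop
        (nhds (1 * φ Set.univ)) :=
      ENNReal.Tendsto.mul_const hc (Or.inl one_ne_zero)
    rw [one_mul] at hl
    rw [← hl.liminf_eq]
    refine liminf_le_liminf (Eventually.of_forall fun n => ?_)
    rw [div_eq_mul_inv, mul_right_comm, ← div_eq_mul_inv]
    refine ENNReal.div_le_div_right ?_ _
    rw [← card_cubeF, ← nsmul_eq_mul]
    exact Finset.card_nsmul_le_sum _ _ _ fun t _ => anti _ _ (Set.subset_univ _)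
  · refine ge_of_tendsto' lim fun m => ?_
    have hi := ratio_pow_tendsto (2 * m) d
    have hu : Tendsto (fun n : ℕ => (((n + 1 - 0) ^ d : ℕ) : ℝ≥0∞) / (n : ℝ≥0∞) ^ d * φ (box d m) +
        ((((n + 1 - 0) ^ d : ℕ) : ℝ≥0∞) / (n : ℝ≥0∞) ^ d -
          (((n + 1 - 2 * m) ^ d : ℕ) : ℝ≥0∞) / (n : ℝ≥0∞) ^ d)) atTop
        (nhds (1 * φ (box d m) + (1 - 1))) :=
      (ENNReal.Tendsto.mul_const hc (Or.inl one_ne_zero)).add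
        (ENNReal.Tendsto.sub hc hi (Or.inl one_ne_top))
    rw [one_mul, tsub_self, add_zero] at hu
    rw [← hu.limsup_eq]
    refine limsup_le_limsup ?_
    filter_upwards [eventually_ge_atTop 1] with n hn
    have hn0 : (n : ℝ≥0∞) ^ d ≠ 0 := pow_ne_zero _ (by simp; omega)
    rw [← ENNReal.sub_div (fun _ _ => hn0)]
    rw [div_eq_mul_inv, div_eq_mul_inv, mul_right_comm, div_eq_mul_inv, ← add_mul]
    gcongr
    rw [← card_cubeF, ← card_innF, ← ENNReal.natCast_sub, ← Finset.card_sdiff_of_subset (innF_sub d n m),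
      ← Finset.sum_sdiff (innF_sub d n m), add_comm]
    gcongr
    · calc _ ≤ ∑ t ∈ innF d n m, φ (box d m) :=
            Finset.sum_le_sum fun t ht => anti _ _ (box_sub_win ht)
        _ = (innF d n m).card * φ (box d m) := by simp
        _ ≤ _ := by
          gcongr
          exact innF_sub d n m
    · calc _ ≤ ∑ t ∈ cubeF d n \ innF d n m, (1 : ℝ≥0∞) := Finset.sum_le_sum fun t ht => h1 _
        _ = _ := by simp

lemma measurable_shift {d : ℕ} (h : Idx d) : Measurable (shift (d := d) h) := by
  unfold shift; fun_prop

lemma homog_shift {d : ℕ} (h : Idx d) (F : Fld d → ℝ≥0∞) (hF : Homog0 F) :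
    Homog0 (fun f => F (shift h f)) := fun c hc f => hF c hc (shift h f)

lemma shift_shift_neg {d : ℕ} (h : Idx d) (f : Fld d) : shift (-h) (shift h f) = f := by
  funext t; simp [shift]

lemma key {d : ℕ} {Ω : Type*} [MeasurableSpace Ω] (P : Measure Ω)
    (Z : Ω → Fld d) (hZ : IsBRS P Z) (w : Fld d → ℝ≥0∞) (ψ : Set (Idx d) → Fld d → ℝ≥0∞)
    (wm : Measurable w) (wh : Homog0 w) (w1 : ∀ f, w f ≤ 1) (ws : ∀ h f, w (shift h f) = w f)
    (pm : ∀ A, Measurable (ψ A)) (ph : ∀ A, Homog0 (ψ A)) (p1 : ∀ A f, ψ A f ≤ 1)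
    (pa : ∀ A B, A ⊆ B → ∀ f, ψ B f ≤ ψ A f)
    (pl : ∀ f, Tendsto (fun m => ψ (box d m) f) atTop (nhds (ψ Set.univ f)))
    (psum : ∀ (C : Finset (Idx d)) f,
      ∑ t ∈ C, (f t : ℝ≥0∞) * ψ (win C t) (shift (-t) f) = ⨆ t ∈ C, (f t : ℝ≥0∞)) :
    Tendsto (fun n : ℕ => (∫⁻ ω, w (Z ω) * ⨆ t ∈ cube d n, (Z ω t : ℝ≥0∞) ∂P) / (n : ℝ≥0∞) ^ d) atTop
      (nhds (∫⁻ ω, (Z ω 0 : ℝ≥0∞) * (w (Z ω) * ψ Set.univ (Z ω)) ∂P)) := by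
  have hm := hZ.meas
  have hmt : ∀ t, Measurable (fun ω => (Z ω t : ℝ≥0∞)) := fun t => by fun_prop
  have hle : ∀ A f, w f * ψ A f ≤ 1 := fun A f => mul_le_one' (w1 f) (p1 A f)
  have hA : ∀ A, Measurable (fun f => w f * ψ A f) := fun A => wm.mul (pm A)
  have hh : ∀ A, Homog0 (fun f => w f * ψ A f) := fun A c hc f => by
    simp only [wh c hc f, ph A c hc f]
  have := count_tendsto (d := d) (fun A => ∫⁻ ω, (Z ω 0 : ℝ≥0∞) * (w (Z ω) * ψ A (Z ω)) ∂P)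
    (fun A => by
      rw [← hZ.mean_one 0]
      exact lintegral_mono fun ω => mul_le_of_le_one_right' (hle _ _))
    (fun A B hAB => lintegral_mono fun ω => by gcongr; exact pa _ _ hAB _)
    (by
      refine tendsto_lintegral_of_dominated_convergence (fun ω => (Z ω 0 : ℝ≥0∞)) ?_ ?_ ?_ ?_
      · exact fun n => (hmt 0).mul ((hA _).comp hm)
      · exact fun n => Eventually.of_forall fun ω => mul_le_of_le_one_right' (hle _ _)
      · rw [hZ.mean_one 0]; simp
      · refine Eventually.of_forall fun ω => ?_
        have hw : w (Z ω) ≠ ∞ := ((w1 _).trans_lt one_lt_top).ne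
        exact ENNReal.Tendsto.const_mul (ENNReal.Tendsto.const_mul (pl _) (Or.inr hw))
          (Or.inr ENNReal.coe_ne_top))
  refine this.congr fun n => ?_
  congr 1
  have h1 : ∀ t, ∫⁻ ω, (Z ω 0 : ℝ≥0∞) * (w (Z ω) * ψ (win (cubeF d n) t) (Z ω)) ∂P =
      ∫⁻ ω, (Z ω t : ℝ≥0∞) * (w (shift (-t) (Z ω)) * ψ (win (cubeF d n) t) (shift (-t) (Z ω))) ∂P := by
    intro t
    rw [hZ.tilt_shift t (fun f => w (shift (-t) f) * ψ (win (cubeF d n) t) (shift (-t) f))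
      ((hA _).comp (measurable_shift _)) (homog_shift (-t) _ (hh _))]
    simp only [shift_shift_neg]
  simp only [h1]
  rw [← lintegral_finsetSum]
  · refine lintegral_congr fun ω => ?_
    have h2 : (⨆ t ∈ cube d n, (Z ω t : ℝ≥0∞)) = ⨆ t ∈ cubeF d n, (Z ω t : ℝ≥0∞) := by
      simp only [mem_cubeF]
    rw [h2, ← psum, Finset.mul_sum]
    refine Finset.sum_congr rfl fun t _ => ?_
    rw [ws]
    ring
  · exact fun t _ => (hmt t).mul (((hA _).comp (measurable_shift _)).comp hm)

lemma fm_inf {d : ℕ} {Ω : Type*} [MeasurableSpace Ω] (P : Measure Ω)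
    (Z : Ω → Fld d) (hZ : IsBRS P Z) : ∀ᵐ ω ∂P, fm Set.univ (Z ω) = wS (Z ω) * fm Set.univ (Z ω) := by
  classical
  have hm := hZ.meas
  have hmt : ∀ t, Measurable (fun ω => (Z ω t : ℝ≥0∞)) := fun t => by fun_prop
  let F : Fld d → ℝ≥0∞ := fun f => (1 - wS f) * fm Set.univ f
  have hFm : Measurable F := (measurable_const.sub measurable_wS).mul (measurable_fm _)
  have hFh : Homog0 F := fun c hc f => by
    simp only [F, homog_wS c hc f, homog_fm _ c hc f]
  have hF1 : ∀ f, ∑' h : Idx d, F (shift h f) ≤ 1 := by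
    intro f
    have hle : ∀ h, F (shift h f) ≤ fm Set.univ (shift h f) := fun h =>
      mul_le_of_le_one_left' tsub_le_self
    have hex : ∃ h₀ : Idx d, ∀ h, h ≠ h₀ → fm Set.univ (shift h f) = 0 := by
      by_cases he : ∃ h₀, FM Set.univ (shift h₀ f)
      · obtain ⟨a, ha⟩ := he
        refine ⟨a, fun b hb => ?_⟩
        have : ¬ FM Set.univ (shift b f) := by
          intro hbb
          have key : ∀ c, FM Set.univ (shift c f) ↔
              ∀ u ∈ (Set.univ : Set (Idx d)), f u ≤ f (-c) ∧ (lxLt u (-c) → f u < f (-c)) := by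
            intro c
            have := FM_win Set.univ (-c) f
            rw [neg_neg] at this
            exact this
          rw [key] at ha hbb
          have h1 := ha (-b) trivial
          have h2 := hbb (-a) trivial
          rcases lxLt_trichotomy (-b) (-a) with h3 | h3 | h3
          · exact absurd (h1.2 h3) (not_lt.2 h2.1)
          · exact hb (neg_injective h3)
          · exact absurd (h2.2 h3) (not_lt.2 h1.1)
        simp [fm, this]
      · refine ⟨0, fun h _ => ?_⟩
        have : ¬ FM Set.univ (shift h f) := fun h2 => he ⟨h, h2⟩
        simp [fm, this]
    obtain ⟨h₀, hh₀⟩ := hex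
    rw [tsum_eq_single h₀ (fun h hh => le_antisymm ((hle h).trans (hh₀ h hh).le) bot_le)]
    exact (hle _).trans (fm_le_one _ _)
  have h1 : ∫⁻ ω, SS (Z ω) * F (Z ω) ∂P ≤ 1 := by
    calc ∫⁻ ω, SS (Z ω) * F (Z ω) ∂P = ∫⁻ ω, ∑' h, (Z ω h : ℝ≥0∞) * F (Z ω) ∂P := by
          simp only [SS, ENNReal.tsum_mul_right]
      _ = ∑' h, ∫⁻ ω, (Z ω h : ℝ≥0∞) * F (Z ω) ∂P :=
          lintegral_tsum fun h => ((hmt h).mul (hFm.comp hm)).aemeasurable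
      _ = ∑' h, ∫⁻ ω, (Z ω 0 : ℝ≥0∞) * F (shift h (Z ω)) ∂P := by
          simp only [hZ.tilt_shift _ F hFm hFh]
      _ = ∫⁻ ω, ∑' h, (Z ω 0 : ℝ≥0∞) * F (shift h (Z ω)) ∂P :=
          (lintegral_tsum fun h => ((hmt 0).mul
            ((hFm.comp (measurable_shift h)).comp hm)).aemeasurable).symm
      _ ≤ ∫⁻ ω, (Z ω 0 : ℝ≥0∞) ∂P := by
          refine lintegral_mono fun ω => ?_
          rw [ENNReal.tsum_mul_left]
          exact mul_le_of_le_one_right' (hF1 _)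
      _ = 1 := hZ.mean_one 0
  have h2 := ae_lt_top ((measurable_SS.comp hm).mul (hFm.comp hm)) (h1.trans_lt one_lt_top).ne
  filter_upwards [h2] with ω hω
  by_cases hS : SS (Z ω) < ∞
  · simp [wS, hS]
  · by_cases hf : FM Set.univ (Z ω)
    · exfalso
      have : SS (Z ω) = ∞ := by simpa using hS
      simp [F, wS, hf, fm, this] at hω
    · simp [fm, hf]

lemma firstMax_iff {d : ℕ} (f : Fld d) (h0 : 0 < f 0) :
    FirstMaxAtZero f ↔ SS f < ∞ ∧ FM Set.univ f := by
  unfold FirstMaxAtZero FM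
  simp only [lexLe_iff]
  constructor
  · rintro ⟨h1, -, h2, h3⟩
    refine ⟨h1, fun s _ => ⟨h2 s, fun hs => lt_of_le_of_ne (h2 s) fun he => ?_⟩⟩
    exact h3 s (fun t => he ▸ h2 t) hs
  · rintro ⟨h1, h2⟩
    refine ⟨h1, ⟨0, h0⟩, fun t => (h2 t trivial).1, fun j hj hlt => ?_⟩
    exact absurd ((h2 j trivial).2 hlt) (not_lt.2 (hj 0))

lemma measurableSet_firstMax {d : ℕ} : MeasurableSet {f : Fld d | FirstMaxAtZero f} := by
  unfold FirstMaxAtZero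
  refine (measurableSet_lt measurable_SS measurable_const).inter (MeasurableSet.inter ?_
    (MeasurableSet.inter ?_ ?_))
  · change MeasurableSet {f : Fld d | ∃ t, 0 < f t}
    simp only [Set.ofPred_exists]
    exact MeasurableSet.iUnion fun t => measurableSet_lt (by fun_prop) (by fun_prop)
  · change MeasurableSet {f : Fld d | ∀ t, f t ≤ f 0}
    simp only [Set.ofPred_forall]
    exact MeasurableSet.iInter fun t => measurableSet_le (by fun_prop) (by fun_prop)
  · change MeasurableSet {f : Fld d | ∀ j, (∀ t, f t ≤ f j) → lexLe 0 j}
    have : {f : Fld d | ∀ j, (∀ t, f t ≤ f j) → lexLe 0 j} =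
        ⋂ j : {j : Idx d // ¬ lexLe 0 j}, (⋂ t : Idx d, {f : Fld d | f t ≤ f j})ᶜ := by
      ext f
      simp only [Set.mem_ofPred_eq, Set.mem_iInter, Set.mem_compl_iff, Subtype.forall]
      exact forall_congr' fun j => not_imp_not.symm.trans Iff.rfl
    rw [this]
    exact MeasurableSet.iInter fun j => (MeasurableSet.iInter fun t =>
      measurableSet_le (by fun_prop) (by fun_prop)).compl

lemma measurableSet_firstExc {d : ℕ} : MeasurableSet {f : Fld d | FirstExcAtZero f} := by
  unfold FirstExcAtZero
  refine (measurableSet_lt measurable_SS measurable_const).inter (MeasurableSet.inter ?_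
    (MeasurableSet.inter ?_ ?_))
  · change MeasurableSet {f : Fld d | ∃ t, 1 < f t}
    simp only [Set.ofPred_exists]
    exact MeasurableSet.iUnion fun t => measurableSet_lt (by fun_prop) (by fun_prop)
  · exact measurableSet_lt (by fun_prop) (by fun_prop)
  · change MeasurableSet {f : Fld d | ∀ j, 1 < f j → lexLe 0 j}
    have : {f : Fld d | ∀ j, 1 < f j → lexLe 0 j} =
        ⋂ j : {j : Idx d // ¬ lexLe 0 j}, ({f : Fld d | 1 < f j})ᶜ := by
      ext f
      simp only [Set.mem_ofPred_eq, Set.mem_iInter, Set.mem_compl_iff, Subtype.forall]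
      exact forall_congr' fun j => not_imp_not.symm.trans Iff.rfl
    rw [this]
    exact MeasurableSet.iInter fun j => (measurableSet_lt (by fun_prop) (by fun_prop)).compl

lemma pareto_calc {d : ℕ} {Ω' : Type*} [MeasurableSpace Ω'] (Q : Measure Ω') [IsProbabilityMeasure Q]
    (R : Ω' → ℝ≥0) (hR : IsUnitPareto Q R) (θ : Fld d) (h0 : θ 0 = 1) :
    Q {ω | FirstExcAtZero (fun t => R ω * θ t)} = wS θ * fe Set.univ θ := by
  by_cases hS : SS θ < ∞
  swap
  · have hS' : SS θ = ∞ := by simpa using hS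
    have : {ω | FirstExcAtZero (fun t => R ω * θ t)} = ∅ := by
      ext ω
      simp only [Set.mem_ofPred_eq, Set.mem_empty_iff_false, iff_false]
      rintro ⟨h1, -, h2, -⟩
      change SS (fun t => R ω * θ t) < ∞ at h1
      have hpos : R ω ≠ 0 := by rintro h; simp [h] at h2
      rw [SS_smul, hS', ENNReal.mul_top (by simpa using hpos)] at h1
      exact lt_irrefl _ h1
    rw [this]
    simp [wS, hS']
  have hs : (⨆ s : {s : Idx d // s ∈ Set.univ ∧ lxLt s 0}, (θ s : ℝ≥0∞)) ≠ ∞ := by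
    refine ((iSup_le fun s => ?_).trans_lt hS).ne
    exact ENNReal.le_tsum (f := fun t => (θ t : ℝ≥0∞)) s.1
  have hset : ∀ r : ℝ≥0, FirstExcAtZero (fun t => r * θ t) ↔ 1 < r ∧
      (r : ℝ≥0∞) * (⨆ s : {s : Idx d // s ∈ Set.univ ∧ lxLt s 0}, (θ s : ℝ≥0∞)) ≤ 1 := by
    intro r
    rw [ENNReal.mul_iSup, iSup_le_iff]
    unfold FirstExcAtZero
    change SS (fun t => r * θ t) < ∞ ∧ _ ↔ _
    rw [SS_smul]
    simp only [lexLe_iff, h0, mul_one, Subtype.forall]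
    constructor
    · rintro ⟨-, -, h1, h2⟩
      refine ⟨h1, fun a ha => ?_⟩
      by_contra hc
      refine h2 a ?_ ha.2
      rw [not_le] at hc
      exact_mod_cast hc
    · rintro ⟨h1, h2⟩
      refine ⟨ENNReal.mul_lt_top (by simp) hS, ⟨0, by simpa [h0] using h1⟩, h1, fun j hj hlt => ?_⟩
      have := h2 j ⟨trivial, hlt⟩
      exact absurd hj (not_lt.2 (by exact_mod_cast this))
  have hw : wS θ * fe Set.univ θ =
      1 - (⨆ s : {s : Idx d // s ∈ Set.univ ∧ lxLt s 0}, (θ s : ℝ≥0∞)) := by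
    simp [wS, hS, fe, h0]
  rw [hw]
  simp only [hset]
  lift (⨆ s : {s : Idx d // s ∈ Set.univ ∧ lxLt s 0}, (θ s : ℝ≥0∞)) to ℝ≥0 using hs with s
  have hone : Q {ω | 1 < R ω} = 1 := by
    have := hR.2 1 le_rfl
    simp only [inv_one, ENNReal.ofReal_one] at this
    rw [← this]
    congr 1
  have hle : ∀ r : ℝ≥0, ((r : ℝ≥0∞) * s ≤ 1) ↔ r * s ≤ 1 := fun r => by norm_cast
  simp only [hle]
  rcases le_or_gt 1 s with h1 | h1
  · have : {ω | 1 < R ω ∧ R ω * s ≤ 1} = ∅ := by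
      ext ω
      simp only [Set.mem_ofPred_eq, Set.mem_empty_iff_false, iff_false, not_and, not_le]
      intro h
      exact lt_of_lt_of_le h (le_mul_of_one_le_right' h1)
    rw [this, measure_empty, tsub_eq_zero_of_le]
    exact_mod_cast h1
  rcases eq_or_ne s 0 with rfl | hs0
  · simpa using hone
  have hspos : 0 < s := pos_iff_ne_zero.2 hs0
  have hset2 : {ω | 1 < R ω ∧ R ω * s ≤ 1} = {ω | 1 < R ω} \ {ω | ((s:ℝ)⁻¹) < (R ω : ℝ)} := by
    ext ω
    simp only [Set.mem_ofPred_eq, Set.mem_sdiff, not_lt, and_congr_right_iff]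
    intro _
    rw [← le_div_iff₀ hspos, one_div]
    rw [← NNReal.coe_le_coe]
    simp
  have h1' : (1:ℝ) ≤ (s:ℝ)⁻¹ := (one_le_inv₀ (by exact_mod_cast hspos)).2 (by exact_mod_cast h1.le)
  rw [hset2, measure_sdiff, hone, hR.2 _ h1', inv_inv, ENNReal.ofReal_coe_nnreal]
  · intro ω hω
    have : (1:ℝ) < R ω := lt_of_le_of_lt h1' hω
    exact_mod_cast this
  · exact (measurableSet_lt measurable_const hR.1.coe_nnreal_real).nullMeasurableSet
  · exact measure_ne_top _ _

lemma law_eq {d : ℕ} {Ω Ω' : Type*} [MeasurableSpace Ω] [MeasurableSpace Ω']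
    (P : Measure Ω) (Q : Measure Ω')
    (Z : Ω → Fld d) (hm : Measurable Z) (Θ : Ω' → Fld d) (hΘ : IsSpectralTail P Z Q Θ)
    (G : Fld d → ℝ≥0∞) (hG : Measurable G) :
    ∫⁻ f, G f ∂(Q.map Θ) = ∫⁻ ω, (Z ω 0 : ℝ≥0∞) * G (fun t => Z ω t / Z ω 0) ∂P := by
  have hmt : ∀ t, Measurable (fun ω => (Z ω t : ℝ≥0∞)) := fun t => by fun_prop
  have hd : Measurable (fun ω t => Z ω t / Z ω 0) := by fun_prop
  have : Q.map Θ = (P.withDensity (fun ω => (Z ω 0 : ℝ≥0∞))).map (fun ω t => Z ω t / Z ω 0) := by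
    ext A hA
    rw [Measure.map_apply hΘ.1 hA, hΘ.2 A hA, Measure.map_apply hd hA,
      withDensity_apply _ (hd hA), ← lintegral_indicator (hd hA)]
    refine lintegral_congr fun ω => ?_
    by_cases h : (fun t => Z ω t / Z ω 0) ∈ A
    · simp [h, Set.indicator]
    · simp [h, Set.indicator]
  rw [this, lintegral_map hG hd]
  exact lintegral_withDensity_eq_lintegral_mul _ (hmt 0) (hG.comp hd)

lemma homog_div {d : ℕ} (F : Fld d → ℝ≥0∞) (hF : Homog0 F) (f : Fld d) (h0 : f 0 ≠ 0) :
    F (fun t => f t / f 0) = F f := by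
  rw [← hF (f 0)⁻¹ (inv_pos.2 (pos_iff_ne_zero.2 h0)) f]
  congr 1
  funext t
  rw [div_eq_mul_inv, mul_comm]

/-- For `Z` Brown–Resnick stationary with `E[Z(t)] = 1`,
`max_t Z(t) > 0` a.s. and `P(Σ_t Z(t) < ∞) > 0`, with spectral tail field `Θ`, unit
Pareto `R` independent of `Θ` and `Y = R·Θ`, the classical extremal index satisfies
`H_Z = P(I_fm(Θ) = 0) = P(I_fe(Y) = 0)`. -/
theorem stmt8 {d : ℕ} (hd : 0 < d) {Ω Ω' : Type*} [MeasurableSpace Ω] [MeasurableSpace Ω']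
    (P : Measure Ω) [IsProbabilityMeasure P] (Q : Measure Ω') [IsProbabilityMeasure Q]
    (Z : Ω → Fld d) (hZ : IsBRS P Z) (hZpos : ∀ᵐ ω ∂P, ∃ t, 0 < Z ω t)
    (hsum : 0 < P {ω | ∑' t : Idx d, (Z ω t : ℝ≥0∞) < ∞})
    (Θ : Ω' → Fld d) (hΘ : IsSpectralTail P Z Q Θ)
    (R : Ω' → ℝ≥0) (hR : IsUnitPareto Q R) (hRΘ : ProbabilityTheory.IndepFun R Θ Q)
    (H : ℝ≥0∞)
    (hH : Tendsto (fun n : ℕ => cubeMaxExp P Z n / (n : ℝ≥0∞) ^ d) atTop (nhds H)) :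
    H = Q {ω | FirstMaxAtZero (Θ ω)} ∧
    H = Q {ω | FirstExcAtZero (fun t => R ω * Θ ω t)} := by
  classical
  have hm := hZ.meas
  have hmt : ∀ t, Measurable (fun ω => (Z ω t : ℝ≥0∞)) := fun t => by fun_prop
  have k0 := key P Z hZ (fun _ => 1) fm measurable_const (fun _ _ _ => rfl) (fun _ => le_rfl)
    (fun _ _ => rfl) measurable_fm homog_fm fm_le_one (fun _ _ h f => fm_anti h f) fm_tendsto fm_sum
  have wsh : ∀ (h : Idx d) (f : Fld d), wS (shift h f) = wS f := fun h f => by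
    unfold wS; rw [SS_shift]
  have k1 := key P Z hZ wS fm measurable_wS homog_wS wS_le_one
    wsh measurable_fm homog_fm fm_le_one (fun _ _ h f => fm_anti h f) fm_tendsto fm_sum
  have k2 := key P Z hZ wS fe measurable_wS homog_wS wS_le_one
    wsh measurable_fe homog_fe fe_le_one (fun _ _ h f => fe_anti h f) fe_tendsto fe_sum
  simp only [one_mul] at k0
  have e0 := tendsto_nhds_unique hH k0
  have e12 := tendsto_nhds_unique k1 k2
  have e01 : H = ∫⁻ ω, (Z ω 0 : ℝ≥0∞) * (wS (Z ω) * fm Set.univ (Z ω)) ∂P := by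
    rw [e0]
    refine lintegral_congr_ae ?_
    filter_upwards [fm_inf P Z hZ] with ω hω
    rw [← hω]
  refine ⟨?_, ?_⟩
  · have hQ := hΘ.2 _ (measurableSet_firstMax (d := d))
    change H = Q (Θ ⁻¹' {f | FirstMaxAtZero f})
    rw [hQ, e01]
    refine lintegral_congr fun ω => ?_
    by_cases h0 : Z ω 0 = 0
    · simp [h0]
    congr 1
    rw [← homog_div _ homog_wS _ h0, ← homog_div _ (homog_fm _) _ h0]
    have h1 : (0 : ℝ≥0) < (fun t => Z ω t / Z ω 0) 0 := by simp [h0]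
    generalize (fun t => Z ω t / Z ω 0) = f at h1
    have h2 := firstMax_iff f h1
    by_cases ha : SS f < ∞ <;> by_cases hb : FM Set.univ f <;>
      simp [Set.indicator, h2, wS, fm, ha, hb]
  · have hT : MeasurableSet {p : ℝ≥0 × Fld d | FirstExcAtZero (fun t => p.1 * p.2 t)} := by
      have hmm : Measurable (fun (p : ℝ≥0 × Fld d) (t : Idx d) => p.1 * p.2 t) := by fun_prop
      exact hmm measurableSet_firstExc
    have hprod := (ProbabilityTheory.indepFun_iff_map_prod_eq_prod_map_map hR.1.aemeasurable
      hΘ.1.aemeasurable).1 hRΘ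
    have hQ1 : Q {ω | FirstExcAtZero (fun t => R ω * Θ ω t)} =
        Q.map (fun ω => (R ω, Θ ω)) {p : ℝ≥0 × Fld d | FirstExcAtZero (fun t => p.1 * p.2 t)} := by
      rw [Measure.map_apply (hR.1.prodMk hΘ.1) hT]
      rfl
    haveI : IsProbabilityMeasure (Q.map R) := Measure.isProbabilityMeasure_map hR.1.aemeasurable
    haveI : IsProbabilityMeasure (Q.map Θ) := Measure.isProbabilityMeasure_map hΘ.1.aemeasurable
    rw [hQ1, hprod, Measure.prod_apply_symm hT, law_eq P Q Z hm Θ hΘ _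
      (measurable_measure_prodMk_right hT), e01, e12]
    refine lintegral_congr fun ω => ?_
    by_cases h0 : Z ω 0 = 0
    · simp [h0]
    congr 1
    rw [← homog_div _ homog_wS _ h0, ← homog_div _ (homog_fe _) _ h0,
      ← pareto_calc Q R hR _ (by simp [h0]),
      Measure.map_apply hR.1 (measurable_prodMk_right hT)]
    rfl
end

section
/- Let Z be a Brown–Resnick stationary random field with values in E satisfying E[Z(t)] = 1 for all t ∈ ℤ^d, max_{t∈ℤ^d} Z(t) > 0 almost surely, and P(Σ_{t∈ℤ^d} Z(t) < ∞) > 0; let Θ be its spectral tail field, R a unit Pareto random variable independent of Θ, and Y = R·Θ. Then the events {Σ_{t∈ℤ^d} 1{Y(t) > 1} < ∞} and {Σ_{t∈ℤ^d} Y(t) < ∞} coincide up to a set of probability zero. -/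
open MeasureTheory ENNReal Filter
open scoped NNReal ENNReal

open Classical in
/-- Indicator that `s` maximises `f`. -/
noncomputable def mxI {d : ℕ} (s : Idx d) (f : Fld d) : ℝ≥0∞ :=
  if ∀ t, f t ≤ f s then 1 else 0

/-- Normalised weight of the maximiser `s`. -/
noncomputable def mxW {d : ℕ} (s : Idx d) (f : Fld d) : ℝ≥0∞ :=
  mxI s f * (∑' t, mxI t f)⁻¹

lemma mxI_meas {d : ℕ} (s : Idx d) : Measurable (mxI s) := by
  classical
  unfold mxI
  refine Measurable.ite ?_ measurable_const measurable_const
  rw [Set.ofPred_forall]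
  exact MeasurableSet.iInter fun t => measurableSet_le (measurable_pi_apply t) (measurable_pi_apply s)

lemma mxW_meas {d : ℕ} (s : Idx d) : Measurable (mxW s) := by
  unfold mxW
  exact (mxI_meas s).mul (Measurable.ennreal_tsum fun t => mxI_meas t).inv

lemma mxI_smul {d : ℕ} (s : Idx d) (c : ℝ≥0) (hc : 0 < c) (f : Fld d) :
    mxI s (fun t => c * f t) = mxI s f := by
  unfold mxI
  have : (∀ t, c * f t ≤ c * f s) ↔ ∀ t, f t ≤ f s :=
    forall_congr' fun t => mul_le_mul_iff_right₀ hc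
  by_cases h : ∀ t, f t ≤ f s
  · rw [if_pos h, if_pos (this.2 h)]
  · rw [if_neg h, if_neg (fun h' => h (this.1 h'))]

lemma mxW_homog {d : ℕ} (s : Idx d) : Homog0 (mxW s) := by
  intro c hc f
  unfold mxW
  simp only [mxI_smul _ c hc f]

lemma mxI_shift {d : ℕ} (s h : Idx d) (f : Fld d) : mxI s (shift h f) = mxI (s - h) f := by
  unfold mxI shift
  have : (∀ t, f (t - h) ≤ f (s - h)) ↔ ∀ t, f t ≤ f (s - h) :=
    ⟨fun H t => by simpa using H (t + h), fun H t => H _⟩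
  by_cases h' : ∀ t, f t ≤ f (s - h)
  · rw [if_pos h', if_pos (this.2 h')]
  · rw [if_neg h', if_neg (fun h2 => h' (this.1 h2))]

lemma mxW_shift {d : ℕ} (s h : Idx d) (f : Fld d) : mxW s (shift h f) = mxW (s - h) f := by
  unfold mxW
  simp only [mxI_shift]
  congr 2
  exact (Equiv.subRight h).tsum_eq (fun t => mxI t f)

lemma mxW_sum {d : ℕ} (f : Fld d) : ∑' s, mxW s f ≤ 1 := by
  unfold mxW
  rw [ENNReal.tsum_mul_right]
  exact ENNReal.mul_inv_le_one _

lemma mx_ae {d : ℕ} {Ω : Type*} [MeasurableSpace Ω] (P : Measure Ω)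
    (Z : Ω → Fld d) (hZ : IsBRS P Z) :
    ∀ᵐ ω ∂P, ∀ s, mxW s (Z ω) ≠ 0 → ∑' t : Idx d, (Z ω t : ℝ≥0∞) ≠ ∞ := by
  rw [ae_all_iff]
  intro s
  have hm : ∀ t, Measurable fun ω => (Z ω t : ℝ≥0∞) := fun t =>
    ((measurable_pi_apply t).comp hZ.meas).coe_nnreal_ennreal
  have hw : ∀ u, Measurable fun ω => mxW u (Z ω) := fun u => (mxW_meas u).comp hZ.meas
  have hp : ∀ t u, Measurable fun ω => (Z ω t : ℝ≥0∞) * mxW u (Z ω) :=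
    fun t u => (hm t).mul (hw u)
  have key : ∫⁻ ω, ∑' t : Idx d, (Z ω t : ℝ≥0∞) * mxW s (Z ω) ∂P ≤ 1 := by
    rw [lintegral_tsum fun t => (hp t s).aemeasurable]
    simp_rw [fun t => hZ.tilt_shift t (mxW s) (mxW_meas s) (mxW_homog s), mxW_shift]
    rw [← lintegral_tsum fun t => (hp 0 (s - t)).aemeasurable]
    rw [← hZ.mean_one 0]
    refine lintegral_mono fun ω => ?_
    simp only
    rw [ENNReal.tsum_mul_left]
    have e : ∑' t, mxW (s - t) (Z ω) = ∑' t, mxW t (Z ω) :=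
      (Equiv.subLeft s).tsum_eq (fun t => mxW t (Z ω))
    rw [e]
    exact (mul_le_mul_right (mxW_sum _) _).trans (mul_one _).le
  have := ae_lt_top (Measurable.ennreal_tsum fun t => hp t s)
    (ne_top_of_le_ne_top one_ne_top key)
  filter_upwards [this] with ω hω h0 htop
  rw [ENNReal.tsum_mul_right, htop, ENNReal.top_mul h0] at hω
  exact lt_irrefl _ hω

/-- The exceptional set. -/
def mxD (d : ℕ) : Set (Fld d) :=
  {f | (∃ s, mxW s f ≠ 0) ∧ ∑' t : Idx d, (f t : ℝ≥0∞) = ∞}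

lemma mxD_meas (d : ℕ) : MeasurableSet (mxD d) := by
  have e : mxD d = (⋃ s, mxW s ⁻¹' {0}ᶜ) ∩
      (fun f : Fld d => ∑' t : Idx d, (f t : ℝ≥0∞)) ⁻¹' {∞} := by
    ext f; simp [mxD]
  rw [e]
  refine MeasurableSet.inter ?_ ?_
  · exact MeasurableSet.iUnion fun s => (mxW_meas s) (measurableSet_singleton 0).compl
  · exact (Measurable.ennreal_tsum fun t =>
      (measurable_pi_apply t).coe_nnreal_ennreal) (measurableSet_singleton ∞)

lemma mxD_smul {d : ℕ} (c : ℝ≥0) (hc : 0 < c) (f : Fld d)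
    (h : (fun t => c * f t) ∈ mxD d) : f ∈ mxD d := by
  obtain ⟨⟨s, hs⟩, h2⟩ := h
  refine ⟨⟨s, ?_⟩, ?_⟩
  · rwa [mxW_homog s c hc f] at hs
  · by_contra h3
    simp only [ENNReal.coe_mul] at h2
    rw [ENNReal.tsum_mul_left] at h2
    exact ENNReal.mul_ne_top ENNReal.coe_ne_top h3 h2

/-- For `Z` Brown–Resnick stationary with `E[Z(t)] = 1`,
`max_t Z(t) > 0` a.s. and `P(Σ_t Z(t) < ∞) > 0`, with spectral tail field `Θ`, unit
Pareto `R` independent of `Θ`, `Y = R·Θ`, the events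
`{Σ_t 1{Y(t) > 1} < ∞}` and `{Σ_t Y(t) < ∞}` coincide up to a `Q`-null set. -/
theorem stmt10 {d : ℕ} (hd : 0 < d) {Ω Ω' : Type*} [MeasurableSpace Ω] [MeasurableSpace Ω']
    (P : Measure Ω) [IsProbabilityMeasure P] (Q : Measure Ω') [IsProbabilityMeasure Q]
    (Z : Ω → Fld d) (hZ : IsBRS P Z) (hZpos : ∀ᵐ ω ∂P, ∃ t, 0 < Z ω t)
    (hsum : 0 < P {ω | ∑' t : Idx d, (Z ω t : ℝ≥0∞) < ∞})
    (Θ : Ω' → Fld d) (hΘ : IsSpectralTail P Z Q Θ)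
    (R : Ω' → ℝ≥0) (hR : IsUnitPareto Q R) (hRΘ : ProbabilityTheory.IndepFun R Θ Q) :
    ∀ᵐ ω ∂Q,
      ((∑' t : Idx d, if 1 < R ω * Θ ω t then (1 : ℝ≥0∞) else 0) < ∞ ↔
        (∑' t : Idx d, ((R ω * Θ ω t : ℝ≥0) : ℝ≥0∞)) < ∞) := by
  have hR1 : ∀ᵐ ω ∂Q, 1 < R ω := by
    have h := hR.2 1 le_rfl
    have e : {ω | (1 : ℝ) < (R ω : ℝ)} = {ω | 1 < R ω} := by
      ext ω; simp only [Set.mem_ofPred_eq]; exact_mod_cast Iff.rfl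
    rw [e, inv_one, ENNReal.ofReal_one] at h
    exact (prob_compl_eq_zero_iff (measurableSet_lt measurable_const hR.1)).2 h
  have hT1 : ∀ᵐ ω ∂Q, Θ ω 0 = 1 := by
    have hms : MeasurableSet {f : Fld d | f 0 ≠ 1} :=
      (measurableSet_eq_fun (measurable_pi_apply (0 : Idx d)) measurable_const).compl
    have h := hΘ.2 _ hms
    have : ∀ ω, (Z ω 0 : ℝ≥0∞) * ({f : Fld d | f 0 ≠ 1}).indicator (fun _ => (1 : ℝ≥0∞))
        (fun t => Z ω t / Z ω 0) = 0 := by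
      intro ω
      by_cases h0 : Z ω 0 = 0
      · simp [h0]
      · rw [Set.indicator_of_notMem, mul_zero]
        simp [div_self h0]
    simp only [this, lintegral_zero] at h
    exact h
  have hD : ∀ᵐ ω ∂Q, Θ ω ∉ mxD d := by
    have h := hΘ.2 _ (mxD_meas d)
    have h' : ∫⁻ ω, (Z ω 0 : ℝ≥0∞) * (mxD d).indicator (fun _ => (1 : ℝ≥0∞))
        (fun t => Z ω t / Z ω 0) ∂P = 0 := by
      rw [lintegral_congr_ae (g := fun _ => 0), lintegral_zero]
      filter_upwards [mx_ae P Z hZ] with ω hω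
      by_cases h0 : Z ω 0 = 0
      · simp [h0]
      · rw [Set.indicator_of_notMem, mul_zero]
        intro hmem
        have h1 : Z ω ∈ mxD d := by
          refine mxD_smul (Z ω 0)⁻¹ (by positivity) _ ?_
          simpa only [div_eq_inv_mul] using hmem
        obtain ⟨⟨s, hs⟩, h2⟩ := h1
        exact hω s hs h2
    rw [h'] at h
    rw [ae_iff]
    simp only [not_not]
    exact h
  filter_upwards [hR1, hT1, hD] with ω h1 h2 h3
  constructor
  · intro hfin
    have hS : {t | 1 < R ω * Θ ω t}.Finite := by
      have := ENNReal.finite_const_le_of_tsum_ne_top hfin.ne one_ne_zero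
      refine this.subset fun t ht => ?_
      simp only [Set.mem_ofPred_eq] at ht ⊢
      simp [ht]
    have h0S : (0 : Idx d) ∈ {t | 1 < R ω * Θ ω t} := by simp [h2, h1]
    obtain ⟨s, hsS, hs⟩ := Set.exists_max_image _ (Θ ω) hS ⟨0, h0S⟩
    have hmax : ∀ t, Θ ω t ≤ Θ ω s := by
      intro t
      by_cases ht : t ∈ {t | 1 < R ω * Θ ω t}
      · exact hs t ht
      · simp only [Set.mem_ofPred_eq, not_lt] at ht hsS
        by_contra hlt
        push Not at hlt
        have : R ω * Θ ω s ≤ R ω * Θ ω t := by gcongr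
        exact absurd (hsS.trans_le (this.trans ht)) (lt_irrefl _)
    have hcnt : ∑' t, mxI t (Θ ω) ≠ ∞ := by
      refine ne_top_of_le_ne_top hfin.ne (ENNReal.tsum_le_tsum fun t => ?_)
      unfold mxI
      split_ifs with ha hb
      · exact le_rfl
      · exfalso
        apply hb
        have := ha 0
        rw [h2] at this
        calc 1 < R ω := h1
          _ = R ω * 1 := (mul_one _).symm
          _ ≤ R ω * Θ ω t := by gcongr
      · simp
      · exact le_rfl
    have hW : mxW s (Θ ω) ≠ 0 := by
      unfold mxW
      have : mxI s (Θ ω) = 1 := by unfold mxI; rw [if_pos hmax]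
      rw [this, one_mul]
      exact ENNReal.inv_ne_zero.2 hcnt
    have hΘs : ∑' t : Idx d, (Θ ω t : ℝ≥0∞) ≠ ∞ := fun h => h3 ⟨⟨s, hW⟩, h⟩
    simp only [ENNReal.coe_mul]
    rw [ENNReal.tsum_mul_left]
    exact ENNReal.mul_lt_top ENNReal.coe_lt_top hΘs.lt_top
  · intro hfin
    refine lt_of_le_of_lt (ENNReal.tsum_le_tsum fun t => ?_) hfin
    split_ifs with h
    · exact_mod_cast h.le
    · exact zero_le
end

section
/- Let Z be a Brown–Resnick stationary random field with values in E satisfying E[Z(t)] = 1 for all t ∈ ℤ^d and max_{t∈ℤ^d} Z(t) > 0 almost surely, let Θ be its spectral tail field, and let X be a random field on ℤ^d with P(X(t₁) ≤ x₁, …, X(t_n) ≤ x_n) = exp(−E[max_{1≤i≤n} Z(t_i)/x_i]) for all finite collections t_i ∈ ℤ^d, x_i > 0. Fix a norm ‖·‖ on ℝ^d. Then the following are equivalent: (a) Θ(t) → 0 almost surely as ‖t‖ → ∞; (b) (anti-clustering Condition C) there exists a non-decreasing sequence of positive integers r_n → ∞ with r_n^d/n → 0 such that for every s > 0, lim_{m→∞}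 limsup_{n→∞} P( max_{t∈ℤ^d, m < ‖t‖ < r_n} X(t) > n s | X(0) > n s ) = 0. -/
open MeasureTheory ENNReal Filter
open scoped NNReal ENNReal

/-- The (sup-)norm of `t ∈ ℤ^d`, viewed in `ℝ^d`. -/
noncomputable def znorm {d : ℕ} (t : Idx d) : ℝ := ‖(fun j => (t j : ℝ) : Fin d → ℝ)‖

namespace Stm

noncomputable def tailSup {d : ℕ} (m : ℕ) (f : Fld d) : ℝ≥0∞ :=
  ⨆ t : Idx d, ⨆ (_ : (m : ℝ) < znorm t), (f t : ℝ≥0∞)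

open Classical in
noncomputable def shell (d m R : ℕ) : Finset (Idx d) :=
  (Fintype.piFinset (fun _ : Fin d => Finset.Icc (-(R : ℤ)) R)).filter
    (fun t => (m : ℝ) < znorm t ∧ znorm t < (R : ℝ))

noncomputable def fsup {d : ℕ} (K : Finset (Idx d)) (f : Fld d) : ℝ≥0∞ :=
  ⨆ t ∈ K, (f t : ℝ≥0∞)

lemma mem_shell {d m R : ℕ} {t : Idx d} :
    t ∈ shell d m R ↔ (m : ℝ) < znorm t ∧ znorm t < (R : ℝ) := by
  classical
  unfold shell
  rw [Finset.mem_filter]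
  refine ⟨fun h => h.2, fun h => ⟨?_, h⟩⟩
  rw [Fintype.mem_piFinset]
  intro j
  have h1 : |(t j : ℝ)| ≤ znorm t := norm_le_pi_norm (fun j => (t j : ℝ) : Fin d → ℝ) j
  have h2 : |(t j : ℝ)| ≤ (R : ℝ) := h1.trans h.2.le
  rw [abs_le] at h2
  rw [Finset.mem_Icc]
  constructor
  · exact_mod_cast h2.1
  · exact_mod_cast h2.2

lemma card_shell (d m R : ℕ) : (shell d m R).card ≤ (2 * R + 1) ^ d := by
  classical
  unfold shell
  refine (Finset.card_filter_le _ _).trans ?_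
  rw [Fintype.card_piFinset]
  simp only [Int.card_Icc, Finset.prod_const, Finset.card_univ, Fintype.card_fin]
  apply Nat.pow_le_pow_left
  omega

lemma measurable_coord {d : ℕ} (t : Idx d) :
    Measurable (fun f : Fld d => (f t : ℝ≥0∞)) :=
  (measurable_pi_apply t).coe_nnreal_ennreal

lemma measurable_tailSup {d : ℕ} (m : ℕ) : Measurable (tailSup (d := d) m) := by
  unfold tailSup
  exact Measurable.iSup fun t => Measurable.iSup fun _ => measurable_coord t

lemma measurable_fsup {d : ℕ} (K : Finset (Idx d)) : Measurable (fsup K) := by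
  unfold fsup
  exact Measurable.iSup fun t => Measurable.iSup fun _ => measurable_coord t

lemma tailSup_antitone {d : ℕ} (f : Fld d) : Antitone (fun m => tailSup m f) := by
  intro m m' h
  refine iSup_mono fun t => ?_
  refine iSup_le fun ht => ?_
  exact le_iSup_of_le (lt_of_le_of_lt (by exact_mod_cast h) ht) le_rfl

lemma iInf_tailSup {d : ℕ} (f : Fld d) :
    (⨅ m, tailSup m f) = 0 ↔
      Tendsto (fun t : Idx d => (f t : ℝ)) (Filter.comap znorm atTop) (nhds 0) := by
  have e : Tendsto (fun t : Idx d => (f t : ℝ)) (Filter.comap znorm atTop) (nhds 0) ↔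
      Tendsto (fun t : Idx d => (f t : ℝ≥0∞)) (Filter.comap znorm atTop) (nhds 0) := by
    rw [← ENNReal.coe_zero, ENNReal.tendsto_coe, ← NNReal.coe_zero, NNReal.tendsto_coe]
  rw [e, ENNReal.tendsto_nhds_zero]
  constructor
  · intro h ε hε
    have : (⨅ m, tailSup m f) < ε := by rw [h]; exact hε
    obtain ⟨m, hm⟩ := iInf_lt_iff.1 this
    have h2 : ∀ᶠ t : Idx d in Filter.comap znorm atTop, (m : ℝ) < znorm t :=
      (eventually_gt_atTop (m : ℝ)).comap _
    filter_upwards [h2] with t ht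
    refine le_trans ?_ hm.le
    exact le_iSup₂_of_le (f := fun (t : Idx d) (_ : (m : ℝ) < znorm t) => (f t : ℝ≥0∞)) t ht le_rfl
  · intro h
    refine le_antisymm (_root_.le_of_forall_pos_le_add ?_) bot_le
    intro ε hε
    rw [zero_add]
    have h1 := h ε hε
    rw [Filter.eventually_comap, Filter.eventually_atTop] at h1
    obtain ⟨a, ha⟩ := h1
    obtain ⟨m, hm⟩ := exists_nat_ge a
    refine iInf_le_of_le m ?_
    refine iSup₂_le fun t ht => ha (znorm t) (hm.trans ht.le) t rfl

lemma tendsto_fsup_shell {d m : ℕ} {r : ℕ → ℕ} (hr : Monotone r) (hr' : Tendsto r atTop atTop)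
    (f : Fld d) : Monotone (fun n => fsup (shell d m (r n)) f) ∧
    Tendsto (fun n => fsup (shell d m (r n)) f) atTop (nhds (tailSup m f)) := by
  have hm : Monotone (fun n => fsup (shell d m (r n)) f) := by
    intro n n' h
    refine iSup_mono fun t => iSup_le fun ht => ?_
    have ht' : t ∈ shell d m (r n') := by
      rw [mem_shell] at ht ⊢
      exact ⟨ht.1, ht.2.trans_le (by exact_mod_cast hr h)⟩
    exact le_iSup_of_le ht' le_rfl
  refine ⟨hm, ?_⟩
  have : tailSup m f = ⨆ n, fsup (shell d m (r n)) f := by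
    apply le_antisymm
    · refine iSup₂_le fun t ht => ?_
      obtain ⟨N, hN⟩ := exists_nat_gt (znorm t)
      obtain ⟨n, hn⟩ := (hr'.eventually (eventually_ge_atTop N)).exists
      refine le_iSup_of_le n ?_
      have : t ∈ shell d m (r n) := mem_shell.2 ⟨ht, hN.trans_le (by exact_mod_cast hn)⟩
      exact le_iSup₂_of_le (f := fun t (_ : t ∈ shell d m (r n)) => (f t : ℝ≥0∞)) t this le_rfl
    · refine iSup_le fun n => iSup₂_le fun t ht => ?_
      exact le_iSup₂_of_le (f := fun (t : Idx d) (_ : (m : ℝ) < znorm t) => (f t : ℝ≥0∞)) t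
        (mem_shell.1 ht).1 le_rfl
  rw [this]
  exact tendsto_atTop_iSup hm

noncomputable def dlt {d : ℕ} {Ω : Type*} [MeasurableSpace Ω] (P : Measure Ω)
    (Z : Ω → Fld d) (m : ℕ) : ℝ≥0∞ :=
  ∫⁻ ω, min (tailSup m (Z ω)) (Z ω 0 : ℝ≥0∞) ∂P

section
variable {d : ℕ} {Ω : Type*} [MeasurableSpace Ω] {P : Measure Ω} {Z : Ω → Fld d}

lemma dlt_tendsto_iff (hZ : IsBRS P Z) :
    Tendsto (dlt P Z) atTop (nhds 0) ↔
      ∀ᵐ ω ∂P, Z ω 0 = 0 ∨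
        Tendsto (fun t : Idx d => (Z ω t : ℝ)) (Filter.comap znorm atTop) (nhds 0) := by
  have hme : ∀ m, Measurable fun ω => min (tailSup m (Z ω)) (Z ω 0 : ℝ≥0∞) := fun m =>
    ((measurable_tailSup m).comp hZ.meas).min ((measurable_coord 0).comp hZ.meas)
  have hanti : ∀ ω, Antitone fun m => min (tailSup m (Z ω)) (Z ω 0 : ℝ≥0∞) := fun ω m m' h =>
    min_le_min (tailSup_antitone (Z ω) h) le_rfl
  have hl : Tendsto (dlt P Z) atTop
      (nhds (∫⁻ ω, ⨅ m, min (tailSup m (Z ω)) (Z ω 0 : ℝ≥0∞) ∂P)) := by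
    refine lintegral_tendsto_of_tendsto_of_antitone (fun m => (hme m).aemeasurable)
      (ae_of_all _ hanti) ?_ (ae_of_all _ fun ω => tendsto_atTop_iInf (hanti ω))
    refine ne_of_lt (lt_of_le_of_lt (lintegral_mono fun ω => min_le_right _ _) ?_)
    rw [hZ.mean_one 0]; exact ENNReal.one_lt_top
  have h1 : Tendsto (dlt P Z) atTop (nhds 0) ↔
      (∫⁻ ω, ⨅ m, min (tailSup m (Z ω)) (Z ω 0 : ℝ≥0∞) ∂P) = 0 :=
    ⟨fun h => tendsto_nhds_unique hl h, fun h => h ▸ hl⟩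
  rw [h1, lintegral_eq_zero_iff (Measurable.iInf hme)]
  refine eventually_congr (ae_of_all _ fun ω => ?_)
  rw [← iInf_tailSup]
  have e : (⨅ m, min (tailSup m (Z ω)) (Z ω 0 : ℝ≥0∞)) =
      min (⨅ m, tailSup m (Z ω)) (Z ω 0 : ℝ≥0∞) := iInf_inf.symm
  simp only [Pi.zero_apply]
  rw [e, _root_.min_eq_zero, ENNReal.coe_eq_zero, or_comm]

lemma theta_iff (hZ : IsBRS P Z) {Ω' : Type*} [MeasurableSpace Ω'] {Q : Measure Ω'}
    {Θ : Ω' → Fld d} (hΘ : IsSpectralTail P Z Q Θ) :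
    (∀ᵐ ω ∂Q,
        Tendsto (fun t : Idx d => (Θ ω t : ℝ)) (Filter.comap znorm atTop) (nhds 0)) ↔
      ∀ᵐ ω ∂P, Z ω 0 = 0 ∨
        Tendsto (fun t : Idx d => (Z ω t : ℝ)) (Filter.comap znorm atTop) (nhds 0) := by
  have hA : MeasurableSet {f : Fld d | (⨅ m, tailSup m f) = 0}ᶜ :=
    ((Measurable.iInf fun m => measurable_tailSup m) (measurableSet_singleton 0)).compl
  simp_rw [← iInf_tailSup]
  have hdiv : Measurable fun ω => (fun t => Z ω t / Z ω 0 : Fld d) := by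
    refine measurable_pi_lambda _ fun t => ?_
    exact ((measurable_pi_apply t).comp hZ.meas).div ((measurable_pi_apply 0).comp hZ.meas)
  rw [ae_iff]
  have := hΘ.2 _ hA
  change Q {ω | ¬ (⨅ m, tailSup m (Θ ω)) = 0} = _ at this
  rw [this, lintegral_eq_zero_iff]
  · refine eventually_congr (ae_of_all _ fun ω => ?_)
    by_cases h0 : Z ω 0 = 0
    · simp [h0]
    have : (⨅ m, tailSup m (fun t => Z ω t / Z ω 0 : Fld d)) = 0 ↔
        (⨅ m, tailSup m (Z ω)) = 0 := by
      rw [iInf_tailSup, iInf_tailSup]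
      have h0' : (Z ω 0 : ℝ) ≠ 0 := by exact_mod_cast h0
      constructor
      · intro h
        have := h.mul_const (Z ω 0 : ℝ)
        rw [zero_mul] at this
        refine this.congr fun t => ?_
        push_cast
        field_simp
      · intro h
        have := h.div_const (Z ω 0 : ℝ)
        rw [zero_div] at this
        refine this.congr fun t => ?_
        push_cast
        rfl
    simp only [h0, false_or, ← this, Pi.zero_apply, mul_eq_zero, ENNReal.coe_eq_zero,
      Set.indicator_apply_eq_zero, Set.mem_compl_iff, Set.mem_setOf_eq, one_ne_zero, imp_false,
      not_not]
  · refine ((measurable_coord 0).comp hZ.meas).mul ?_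
    exact (measurable_const.indicator hA).comp hdiv

lemma fsup_le (hZ : IsBRS P Z) (K : Finset (Idx d)) :
    ∫⁻ ω, fsup K (Z ω) ∂P ≤ K.card := by
  calc ∫⁻ ω, fsup K (Z ω) ∂P ≤ ∫⁻ ω, ∑ t ∈ K, (Z ω t : ℝ≥0∞) ∂P := by
        refine lintegral_mono fun ω => iSup₂_le fun t ht => ?_
        exact Finset.single_le_sum (f := fun t => (Z ω t : ℝ≥0∞)) (fun _ _ => bot_le) ht
    _ = ∑ t ∈ K, ∫⁻ ω, (Z ω t : ℝ≥0∞) ∂P :=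
        lintegral_finsetSum _ fun t _ => (measurable_coord t).comp hZ.meas
    _ = K.card := by simp [hZ.mean_one]

lemma prob_le [IsProbabilityMeasure P] (hZ : IsBRS P Z) (X : Ω → Idx d → ℝ)
    (hfidi : ∀ (n : ℕ) (t : Fin n → Idx d) (x : Fin n → ℝ≥0), (∀ i, 0 < x i) →
      P {ω | ∀ i, X ω (t i) ≤ (x i : ℝ)} =
        ENNReal.ofReal
          (Real.exp (-(∫⁻ ω, ⨆ i, (Z ω (t i) : ℝ≥0∞) / (x i : ℝ≥0∞) ∂P).toReal)))
    (K : Finset (Idx d)) (y : ℝ) (hy : 0 < y) :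
    P.real {ω | ∀ t ∈ K, X ω t ≤ y} =
      Real.exp (-((∫⁻ ω, fsup K (Z ω) ∂P).toReal / y)) := by
  lift y to ℝ≥0 using hy.le
  have hy' : 0 < y := by exact_mod_cast hy
  have h := hfidi K.card (fun i => (K.equivFin.symm i : Idx d)) (fun _ => y) (fun _ => hy')
  have e1 : {ω | ∀ i, X ω (K.equivFin.symm i : Idx d) ≤ (y : ℝ)} =
      {ω | ∀ t ∈ K, X ω t ≤ (y : ℝ)} := by
    ext ω
    simp only [Set.mem_setOf_eq]
    rw [← K.equivFin.symm.forall_congr_right (q := fun t : K => X ω t ≤ (y : ℝ)).symm]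
    simp
  have e2 : ∀ ω, (⨆ i, (Z ω (K.equivFin.symm i : Idx d) : ℝ≥0∞) / (y : ℝ≥0∞)) =
      fsup K (Z ω) / y := by
    intro ω
    rw [K.equivFin.symm.iSup_comp (g := fun t : K => (Z ω t : ℝ≥0∞) / (y : ℝ≥0∞)),
      ← ENNReal.iSup_div, iSup_subtype]
    rfl
  rw [measureReal_def, ← e1, h, ENNReal.toReal_ofReal (Real.exp_pos _).le]
  simp_rw [e2, div_eq_mul_inv]
  have mK : Measurable fun ω => fsup K (Z ω) := (measurable_fsup K).comp hZ.meas
  rw [lintegral_mul_const _ mK, ENNReal.toReal_mul]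
  simp

lemma ratio_bounds [IsProbabilityMeasure P] (hZ : IsBRS P Z) (X : Ω → Idx d → ℝ)
    (hXmeas : ∀ t, Measurable fun ω => X ω t)
    (hfidi : ∀ (n : ℕ) (t : Fin n → Idx d) (x : Fin n → ℝ≥0), (∀ i, 0 < x i) →
      P {ω | ∀ i, X ω (t i) ≤ (x i : ℝ)} =
        ENNReal.ofReal
          (Real.exp (-(∫⁻ ω, ⨆ i, (Z ω (t i) : ℝ≥0∞) / (x i : ℝ≥0∞) ∂P).toReal)))
    (K : Finset (Idx d)) (y : ℝ) (hy : 0 < y) (δ : ℝ)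
    (hδ : δ = (∫⁻ ω, min (fsup K (Z ω)) (Z ω 0 : ℝ≥0∞) ∂P).toReal) :
    ∃ ρ : ℝ, P {ω | (∃ t ∈ K, y < X ω t) ∧ y < X ω 0} / P {ω | y < X ω 0} = ENNReal.ofReal ρ ∧
      Real.exp (-((K.card + 2) / y)) * δ ≤ ρ ∧ ρ ≤ K.card / y + δ * Real.exp (1 / y) := by
  classical
  set a := (∫⁻ ω, fsup K (Z ω) ∂P).toReal with ha
  set c := (∫⁻ ω, fsup (insert 0 K) (Z ω) ∂P).toReal with hc
  have fin : ∀ K, ∫⁻ ω, fsup K (Z ω) ∂P ≠ ⊤ := fun K =>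
    ((fsup_le hZ K).trans_lt (ENNReal.natCast_lt_top _)).ne
  have mK : Measurable fun ω => fsup K (Z ω) := (measurable_fsup K).comp hZ.meas
  have m0 : Measurable fun ω => (Z ω 0 : ℝ≥0∞) := (measurable_coord 0).comp hZ.meas
  have hmin1 : ∫⁻ ω, min (fsup K (Z ω)) (Z ω 0 : ℝ≥0∞) ∂P ≤ 1 := by
    rw [← hZ.mean_one 0]; exact lintegral_mono fun ω => min_le_right _ _
  have hsum : δ + c = a + 1 := by
    have : ∫⁻ ω, min (fsup K (Z ω)) (Z ω 0 : ℝ≥0∞) ∂P + ∫⁻ ω, fsup (insert 0 K) (Z ω) ∂P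
        = ∫⁻ ω, fsup K (Z ω) ∂P + 1 := by
      rw [← hZ.mean_one 0, ← lintegral_add_left mK, ← lintegral_add_left (mK.min m0)]
      refine lintegral_congr fun ω => ?_
      have : fsup (insert 0 K) (Z ω) = max (fsup K (Z ω)) (Z ω 0 : ℝ≥0∞) := by
        unfold fsup
        rw [Finset.iSup_insert, sup_comm]
      rw [this, min_add_max]
    have h2 := congrArg ENNReal.toReal this
    rw [ENNReal.toReal_add (hmin1.trans_lt ENNReal.one_lt_top).ne (fin _),
      ENNReal.toReal_add (fin _) ENNReal.one_ne_top] at h2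
    rw [hδ, ha, hc, h2]; simp
  have hδ0 : 0 ≤ δ := hδ ▸ ENNReal.toReal_nonneg
  have hδ1 : δ ≤ 1 := by
    rw [hδ]; exact ENNReal.toReal_le_of_le_ofReal zero_le_one (by simpa using hmin1)
  have ha0 : 0 ≤ a := ENNReal.toReal_nonneg
  have haK : a ≤ K.card := by
    have := ENNReal.toReal_mono (by simp) (fsup_le hZ K)
    simpa using this
  have pA : P.real {ω | ∃ t ∈ K, y < X ω t}ᶜ = Real.exp (-(a / y)) := by
    rw [← prob_le hZ X hfidi K y hy]
    congr 1; ext ω; simp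
  have pB : P.real {ω | y < X ω 0}ᶜ = Real.exp (-(1 / y)) := by
    have := prob_le hZ X hfidi {0} y hy
    simp only [Finset.mem_singleton, forall_eq, fsup, iSup_iSup_eq_left, hZ.mean_one,
      ENNReal.toReal_one] at this
    rw [← this]
    congr 1; ext ω; simp
  have pAB : P.real ({ω | ∃ t ∈ K, y < X ω t} ∪ {ω | y < X ω 0})ᶜ = Real.exp (-(c / y)) := by
    rw [← prob_le hZ X hfidi (insert 0 K) y hy]
    congr 1; ext ω
    constructor
    · intro h t ht
      by_contra hlt
      rw [not_le] at hlt
      rcases Finset.mem_insert.1 ht with rfl | ht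
      · exact h (Or.inr hlt)
      · exact h (Or.inl ⟨t, ht, hlt⟩)
    · rintro h (⟨t, ht, hlt⟩ | hlt)
      · exact absurd (h t (Finset.mem_insert_of_mem ht)) (not_le.2 hlt)
      · exact absurd (h 0 (Finset.mem_insert_self _ _)) (not_le.2 hlt)
  have mA : MeasurableSet {ω | ∃ t ∈ K, y < X ω t} := by
    have : {ω | ∃ t ∈ K, y < X ω t} = ⋃ t ∈ K, {ω | y < X ω t} := by ext; simp
    rw [this]
    exact Finset.measurableSet_biUnion K fun t _ => measurableSet_lt measurable_const (hXmeas t)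
  have mB : MeasurableSet {ω | y < X ω 0} := measurableSet_lt measurable_const (hXmeas 0)
  rw [probReal_compl_eq_one_sub mA] at pA
  rw [probReal_compl_eq_one_sub mB] at pB
  rw [probReal_compl_eq_one_sub (mA.union mB)] at pAB
  have hIE := measureReal_union_add_inter (μ := P) (s := {ω | ∃ t ∈ K, y < X ω t}) mB
  have hb : 0 < 1 / y := by positivity
  have hBpos : 0 < P.real {ω | y < X ω 0} := by
    have : Real.exp (-(1 / y)) < 1 := by rw [Real.exp_lt_one_iff]; linarith
    linarith
  refine ⟨P.real ({ω | ∃ t ∈ K, y < X ω t} ∩ {ω | y < X ω 0}) / P.real {ω | y < X ω 0}, ?_, ?_⟩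
  · rw [ENNReal.ofReal_div_of_pos hBpos, ofReal_measureReal, ofReal_measureReal]
    rfl
  have hnum : P.real ({ω | ∃ t ∈ K, y < X ω t} ∩ {ω | y < X ω 0}) =
      (1 - Real.exp (-(a / y))) * (1 - Real.exp (-(1 / y))) +
        Real.exp (-(c / y)) * (1 - Real.exp (-(δ / y))) := by
    have : Real.exp (-(c / y)) * Real.exp (-(δ / y)) =
        Real.exp (-(a / y)) * Real.exp (-(1 / y)) := by
      rw [← Real.exp_add, ← Real.exp_add]
      congr 1
      have : c / y + δ / y = a / y + 1 / y := by rw [← add_div, ← add_div, add_comm c, hsum]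
      linarith
    linear_combination hIE + pAB - pA - pB + this
  have hden : P.real {ω | y < X ω 0} = 1 - Real.exp (-(1 / y)) := by linarith
  rw [hden] at hBpos
  rw [hnum, hden]
  have hay : 0 ≤ a / y := by positivity
  have hdy : 0 ≤ δ / y := by positivity
  have hc0 : 0 ≤ c := ENNReal.toReal_nonneg
  have hcy : 0 ≤ c / y := by positivity
  have ea : 1 - Real.exp (-(a / y)) ≤ a / y := by linarith [Real.add_one_le_exp (-(a / y))]
  have ea0 : 0 ≤ 1 - Real.exp (-(a / y)) := by
    have : Real.exp (-(a / y)) ≤ 1 := by rw [Real.exp_le_one_iff]; linarith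
    linarith
  have ec : Real.exp (-(c / y)) ≤ 1 := by rw [Real.exp_le_one_iff]; linarith
  have ed : 1 - Real.exp (-(δ / y)) ≤ δ / y := by linarith [Real.add_one_le_exp (-(δ / y))]
  have eb : 1 - Real.exp (-(1 / y)) ≤ 1 / y := by linarith [Real.add_one_le_exp (-(1 / y))]
  have low : ∀ x : ℝ, x * Real.exp (-x) ≤ 1 - Real.exp (-x) := by
    intro x
    have h1 := Real.add_one_le_exp x
    have h2 : Real.exp x * Real.exp (-x) = 1 := by rw [← Real.exp_add]; simp
    nlinarith [Real.exp_pos (-x)]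
  have ed0 : 0 ≤ 1 - Real.exp (-(δ / y)) := le_trans (by positivity) (low (δ / y))
  constructor
  · rw [le_div_iff₀ hBpos]
    have k1 : Real.exp (-((K.card + 2) / y)) ≤ Real.exp (-(c / y)) * Real.exp (-(δ / y)) := by
      rw [← Real.exp_add, Real.exp_le_exp]
      have : (δ + c) / y ≤ (K.card + 2) / y := by
        refine div_le_div_of_nonneg_right ?_ hy.le
        linarith
      rw [add_div] at this
      linarith
    calc Real.exp (-((K.card + 2) / y)) * δ * (1 - Real.exp (-(1 / y)))
        ≤ Real.exp (-(c / y)) * Real.exp (-(δ / y)) * δ * (1 / y) := by gcongr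
      _ = Real.exp (-(c / y)) * (δ / y * Real.exp (-(δ / y))) := by ring
      _ ≤ Real.exp (-(c / y)) * (1 - Real.exp (-(δ / y))) := by
          gcongr; exact low _
      _ ≤ _ := by
          have := mul_nonneg ea0 hBpos.le
          linarith
  · rw [div_le_iff₀ hBpos]
    have k1 : 1 / y ≤ Real.exp (1 / y) * (1 - Real.exp (-(1 / y))) := by
      have h2 : Real.exp (1 / y) * Real.exp (-(1 / y)) = 1 := by rw [← Real.exp_add]; simp
      nlinarith [Real.add_one_le_exp (1 / y)]
    have k2 : Real.exp (-(c / y)) * (1 - Real.exp (-(δ / y))) ≤ δ * (1 / y) := by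
      calc _ ≤ 1 * (δ / y) := by gcongr
        _ = _ := by ring
    have k3 : (1 - Real.exp (-(a / y))) * (1 - Real.exp (-(1 / y))) ≤
        K.card / y * (1 - Real.exp (-(1 / y))) := by
      gcongr
      exact ea.trans (by gcongr)
    have k4 := mul_le_mul_of_nonneg_left k1 hδ0
    linarith

lemma ratio_tendsto [IsProbabilityMeasure P] (hZ : IsBRS P Z) (X : Ω → Idx d → ℝ)
    (hXmeas : ∀ t, Measurable fun ω => X ω t)
    (hfidi : ∀ (n : ℕ) (t : Fin n → Idx d) (x : Fin n → ℝ≥0), (∀ i, 0 < x i) →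
      P {ω | ∀ i, X ω (t i) ≤ (x i : ℝ)} =
        ENNReal.ofReal
          (Real.exp (-(∫⁻ ω, ⨆ i, (Z ω (t i) : ℝ≥0∞) / (x i : ℝ≥0∞) ∂P).toReal)))
    (r : ℕ → ℕ) (hr : Monotone r) (hr0 : ∀ n, 0 < r n) (hr1 : Tendsto (fun n => r n) atTop atTop)
    (hr2 : Tendsto (fun n : ℕ => ((r n : ℝ)) ^ d / (n : ℝ)) atTop (nhds 0))
    (s : ℝ) (hs : 0 < s) (m : ℕ) :
    Tendsto (fun n : ℕ =>
      P {ω | (∃ t : Idx d, (m : ℝ) < znorm t ∧ znorm t < (r n : ℝ) ∧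
                      (n : ℝ) * s < X ω t) ∧ (n : ℝ) * s < X ω 0} /
                    P {ω | (n : ℝ) * s < X ω 0}) atTop (nhds (dlt P Z m)) := by
  set δ : ℕ → ℝ := fun n =>
    (∫⁻ ω, min (fsup (shell d m (r n)) (Z ω)) (Z ω 0 : ℝ≥0∞) ∂P).toReal with hδ
  have hfin : dlt P Z m ≠ ⊤ := by
    refine ne_of_lt (lt_of_le_of_lt (lintegral_mono fun ω => min_le_right _ _) ?_)
    rw [hZ.mean_one 0]; exact ENNReal.one_lt_top
  have hδlim : Tendsto δ atTop (nhds (dlt P Z m).toReal) := by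
    refine (ENNReal.tendsto_toReal hfin).comp ?_
    refine lintegral_tendsto_of_tendsto_of_monotone (fun n => ?_) (ae_of_all _ fun ω => ?_)
      (ae_of_all _ fun ω => ?_)
    · exact (((measurable_fsup _).comp hZ.meas).min ((measurable_coord 0).comp hZ.meas)).aemeasurable
    · intro n n' h
      exact min_le_min ((tendsto_fsup_shell hr hr1 (Z ω)).1 h) le_rfl
    · exact (tendsto_fsup_shell hr hr1 (Z ω)).2.min tendsto_const_nhds
  have H : ∀ n : ℕ, ∃ ρ : ℝ, 0 < n →
      P {ω | (∃ t : Idx d, (m : ℝ) < znorm t ∧ znorm t < (r n : ℝ) ∧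
                      (n : ℝ) * s < X ω t) ∧ (n : ℝ) * s < X ω 0} /
                    P {ω | (n : ℝ) * s < X ω 0} = ENNReal.ofReal ρ ∧
      Real.exp (-(((shell d m (r n)).card + 2) / (n * s))) * δ n ≤ ρ ∧
      ρ ≤ (shell d m (r n)).card / (n * s) + δ n * Real.exp (1 / (n * s)) := by
    intro n
    by_cases hn : 0 < n
    · obtain ⟨ρ, h1, h2⟩ := ratio_bounds hZ X hXmeas hfidi (shell d m (r n)) (n * s)
        (by positivity) (δ n) rfl
      refine ⟨ρ, fun _ => ⟨?_, h2⟩⟩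
      rw [← h1]
      simp only [mem_shell, and_assoc]
    · exact ⟨0, fun h => absurd h hn⟩
  choose ρ hρ using H
  have l1 : Tendsto (fun n : ℕ => 1 / ((n : ℝ) * s)) atTop (nhds 0) := by
    have := (tendsto_one_div_atTop_nhds_zero_nat (𝕜 := ℝ)).mul_const (1 / s)
    rw [zero_mul] at this
    refine this.congr fun n => ?_
    rw [one_div_mul_one_div]
  have lK : Tendsto (fun n : ℕ => ((shell d m (r n)).card : ℝ) / ((n : ℝ) * s)) atTop (nhds 0) := by
    have := hr2.mul_const (3 ^ d / s)
    rw [zero_mul] at this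
    refine squeeze_zero (fun n => by positivity) (fun n => ?_) this
    have h1 : ((shell d m (r n)).card : ℝ) ≤ (3 * r n) ^ d := by
      have h2 := (card_shell d m (r n)).trans
        (Nat.pow_le_pow_left (show 2 * r n + 1 ≤ 3 * r n by have := hr0 n; omega) d)
      exact_mod_cast h2
    calc _ ≤ (3 * r n : ℝ) ^ d / (n * s) := by gcongr
      _ = _ := by rw [mul_pow, mul_comm, mul_div_mul_comm]
  have lρ : Tendsto ρ atTop (nhds (dlt P Z m).toReal) := by
    have lo : Tendsto (fun n : ℕ => Real.exp (-(((shell d m (r n)).card + 2) / (n * s))) * δ n)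
        atTop (nhds (dlt P Z m).toReal) := by
      have : Tendsto (fun n : ℕ => -((((shell d m (r n)).card : ℝ) + 2) / (n * s))) atTop
          (nhds 0) := by
        have := (lK.add (l1.const_mul 2)).neg
        simp only [mul_zero, add_zero, neg_zero] at this
        refine this.congr fun n => ?_
        ring
      have := ((Real.continuous_exp.tendsto 0).comp this).mul hδlim
      simpa using this
    have up : Tendsto (fun n : ℕ => ((shell d m (r n)).card : ℝ) / (n * s) +
        δ n * Real.exp (1 / (n * s))) atTop (nhds (dlt P Z m).toReal) := by
      have := lK.add (hδlim.mul ((Real.continuous_exp.tendsto 0).comp l1))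
      simpa using this
    refine tendsto_of_tendsto_of_tendsto_of_le_of_le' lo up ?_ ?_
    · filter_upwards [eventually_gt_atTop 0] with n hn using (hρ n hn).2.1
    · filter_upwards [eventually_gt_atTop 0] with n hn using (hρ n hn).2.2
  have := ENNReal.tendsto_ofReal lρ
  rw [ENNReal.ofReal_toReal hfin] at this
  refine this.congr' ?_
  filter_upwards [eventually_gt_atTop 0] with n hn using (hρ n hn).1.symm

end

lemma exists_r (d : ℕ) : ∃ r : ℕ → ℕ, Monotone r ∧ (∀ n, 0 < r n) ∧
        Tendsto (fun n => (r n : ℕ)) atTop atTop ∧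
        Tendsto (fun n : ℕ => ((r n : ℝ)) ^ d / (n : ℝ)) atTop (nhds 0) := by
  refine ⟨fun n => Nat.log 2 n + 1, fun a b h => by simpa using Nat.log_mono_right h,
    fun n => Nat.succ_pos _, ?_, ?_⟩
  · refine tendsto_atTop_mono (fun n => Nat.le_succ _) ?_
    refine tendsto_atTop.2 fun b => ?_
    filter_upwards [eventually_ge_atTop (2 ^ b)] with n hn
    exact (Nat.le_log_iff_pow_le (by norm_num) (by have := Nat.two_pow_pos b; omega)).2 hn
  · have h := (Real.isLittleO_pow_log_id_atTop (n := d)).tendsto_div_nhds_zero.comp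
      tendsto_natCast_atTop_atTop (α := ℕ)
    have h2 := h.const_mul ((1 / Real.log 2 + 1) ^ d)
    rw [mul_zero] at h2
    refine tendsto_of_tendsto_of_tendsto_of_le_of_le' tendsto_const_nhds h2
      (Eventually.of_forall fun n => by positivity) ?_
    filter_upwards [eventually_ge_atTop 3] with n hn
    have hn0 : (0 : ℝ) < n := by positivity
    have l2 : 0 < Real.log 2 := Real.log_pos (by norm_num)
    have hlog1 : 1 ≤ Real.log n := by
      rw [Real.le_log_iff_exp_le hn0]
      have : (3 : ℝ) ≤ n := by exact_mod_cast hn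
      linarith [Real.exp_one_lt_d9]
    have hl : (Nat.log 2 n : ℝ) ≤ 1 / Real.log 2 * Real.log n := by
      have := Real.natLog_le_logb n 2
      rw [Real.logb] at this
      push_cast at this
      rw [one_div_mul_eq_div]
      exact this
    simp only [Function.comp, id]
    rw [← mul_div_assoc, ← mul_pow]
    push_cast
    gcongr
    linarith

end Stm

/-- Let `Z` be Brown–Resnick stationary with `E[Z(t)] = 1` and
`max_t Z(t) > 0` a.s., `Θ` its spectral tail field, and `X` the associated max-stable
field with `P(X(t₁) ≤ x₁,…,X(tₙ) ≤ xₙ) = exp(-E[max_i Z(tᵢ)/xᵢ])`.  The following are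
equivalent: (a) `Θ(t) → 0` a.s. as `‖t‖ → ∞`; (b) the anti-clustering Condition C:
there is a non-decreasing sequence of positive integers `r_n → ∞` with `r_n^d/n → 0`
such that for every `s > 0`,
`lim_{m→∞} limsup_{n→∞} P(max_{m<‖t‖<r_n} X(t) > n s ∣ X(0) > n s) = 0`. -/
theorem stmt11 {d : ℕ} (hd : 0 < d) {Ω Ω' : Type*} [MeasurableSpace Ω] [MeasurableSpace Ω']
    (P : Measure Ω) [IsProbabilityMeasure P] (Q : Measure Ω') [IsProbabilityMeasure Q]
    (Z : Ω → Fld d) (hZ : IsBRS P Z) (hZpos : ∀ᵐ ω ∂P, ∃ t, 0 < Z ω t)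
    (Θ : Ω' → Fld d) (hΘ : IsSpectralTail P Z Q Θ)
    (X : Ω → Idx d → ℝ) (hXmeas : ∀ t, Measurable fun ω => X ω t)
    (hfidi : ∀ (n : ℕ) (t : Fin n → Idx d) (x : Fin n → ℝ≥0), (∀ i, 0 < x i) →
      P {ω | ∀ i, X ω (t i) ≤ (x i : ℝ)} =
        ENNReal.ofReal
          (Real.exp (-(∫⁻ ω, ⨆ i, (Z ω (t i) : ℝ≥0∞) / (x i : ℝ≥0∞) ∂P).toReal))) :
    ((∀ᵐ ω ∂Q,
        Tendsto (fun t : Idx d => (Θ ω t : ℝ)) (Filter.comap znorm atTop) (nhds 0)) ↔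
      (∃ r : ℕ → ℕ, Monotone r ∧ (∀ n, 0 < r n) ∧
        Tendsto (fun n => (r n : ℕ)) atTop atTop ∧
        Tendsto (fun n : ℕ => ((r n : ℝ)) ^ d / (n : ℝ)) atTop (nhds 0) ∧
        ∀ s : ℝ, 0 < s →
          Tendsto
            (fun m : ℕ =>
              Filter.limsup
                (fun n : ℕ =>
                  P {ω | (∃ t : Idx d, (m : ℝ) < znorm t ∧ znorm t < (r n : ℝ) ∧
                      (n : ℝ) * s < X ω t) ∧ (n : ℝ) * s < X ω 0} /
                    P {ω | (n : ℝ) * s < X ω 0})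
                atTop)
            atTop (nhds 0))) := by
  rw [Stm.theta_iff hZ hΘ, ← Stm.dlt_tendsto_iff hZ]
  constructor
  · intro h
    obtain ⟨r, h1, h2, h3, h4⟩ := Stm.exists_r d
    refine ⟨r, h1, h2, h3, h4, fun s hs => ?_⟩
    refine h.congr fun m => ?_
    exact (Stm.ratio_tendsto hZ X hXmeas hfidi r h1 h2 h3 h4 s hs m).limsup_eq.symm
  · rintro ⟨r, h1, h2, h3, h4, h5⟩
    refine (h5 1 one_pos).congr fun m => ?_
    exact (Stm.ratio_tendsto hZ X hXmeas hfidi r h1 h2 h3 h4 1 one_pos m).limsup_eq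
end

section
/- For i = 1, 2 let W_i be a centered Gaussian random field on ℤ^d with W_i(0) = 0 almost surely and stationary increments (i.e., for every h ∈ ℤ^d the field (W_i(t+h) − W_i(h))_{t∈ℤ^d} has the same finite-dimensional distributions as (W_i(t))_{t∈ℤ^d}), and variance function σ_i²(t) = Var(W_i(t)). Assume that for each i the limit θ_i = lim_{n→∞} n^{−d} E[max_{t∈{0,…,n}^d} exp(W_i(t) − σ_i²(t)/2)] exists (these are the extremal indices of the associated stationary max-stable Brown–Resnick fields). If σ₁(t) ≥ σ₂(t) for all t ∈ ℤ^d, then θ₁ ≥ θ₂. -/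
open MeasureTheory ENNReal Filter
open scoped NNReal ENNReal

/-- `W` is a centered Gaussian random field on `ℤ^d`: every finite linear combination
of its values is a centered Gaussian real random variable. -/
def IsCenteredGaussianField {d : ℕ} {Ω : Type*} [MeasurableSpace Ω] (P : Measure Ω)
    (W : Ω → Idx d → ℝ) : Prop :=
  (∀ t, Measurable fun ω => W ω t) ∧
  ∀ (n : ℕ) (a : Fin n → ℝ) (t : Fin n → Idx d), ∃ v : ℝ≥0,
    Measure.map (fun ω => ∑ j, a j * W ω (t j)) P = ProbabilityTheory.gaussianReal 0 v

/-- `W` has stationary increments: for every `h` the field `(W(t+h) - W(h))_t` has the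
same finite-dimensional distributions as `W`. -/
def HasStationaryIncrements {d : ℕ} {Ω : Type*} [MeasurableSpace Ω] (P : Measure Ω)
    (W : Ω → Idx d → ℝ) : Prop :=
  ∀ (h : Idx d) (n : ℕ) (t : Fin n → Idx d),
    Measure.map (fun ω => fun j => W ω (t j + h) - W ω h) P =
      Measure.map (fun ω => fun j => W ω (t j)) P


open ProbabilityTheory

/-- exponential growth bound -/
def ExpB {E : Type*} [NormedAddCommGroup E] (f : E → ℝ) : Prop :=
  ∃ K : ℝ, 0 ≤ K ∧ ∀ x, |f x| ≤ K * Real.exp (K * ‖x‖)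

namespace ExpB
variable {E : Type*} [NormedAddCommGroup E]

lemma mono {f g : E → ℝ} (hg : ExpB g) (h : ∀ x, |f x| ≤ g x) : ExpB f := by
  obtain ⟨K, hK, hg⟩ := hg
  exact ⟨K, hK, fun x => (h x).trans ((le_abs_self _).trans (hg x))⟩

lemma const (c : ℝ) : ExpB (fun _ : E => c) := by
  refine ⟨|c|, abs_nonneg _, fun x => ?_⟩
  have : 1 ≤ Real.exp (|c| * ‖x‖) := Real.one_le_exp (by positivity)
  nlinarith [abs_nonneg c]

lemma exp_norm (c : ℝ) : ExpB (fun x : E => Real.exp (c * ‖x‖)) := by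
  refine ⟨max 1 c, by positivity, fun x => ?_⟩
  rw [Real.abs_exp]
  have h1 : Real.exp (c * ‖x‖) ≤ Real.exp (max 1 c * ‖x‖) := by
    gcongr; exact le_max_right _ _
  have h2 : (1:ℝ) ≤ max 1 c := le_max_left _ _
  nlinarith [Real.exp_pos (max 1 c * ‖x‖)]

lemma norm : ExpB (fun x : E => ‖x‖) := by
  refine (exp_norm 1).mono fun x => ?_
  rw [abs_norm, one_mul]
  linarith [Real.add_one_le_exp ‖x‖]

lemma add {f g : E → ℝ} (hf : ExpB f) (hg : ExpB g) : ExpB (fun x => f x + g x) := by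
  obtain ⟨K, hK, hf⟩ := hf
  obtain ⟨L, hL, hg⟩ := hg
  refine ⟨K + L, by positivity, fun x => ?_⟩
  have h1 : Real.exp (K * ‖x‖) ≤ Real.exp ((K + L) * ‖x‖) := by gcongr; linarith
  have h2 : Real.exp (L * ‖x‖) ≤ Real.exp ((K + L) * ‖x‖) := by gcongr; linarith
  calc |f x + g x| ≤ |f x| + |g x| := abs_add_le _ _
    _ ≤ K * Real.exp (K * ‖x‖) + L * Real.exp (L * ‖x‖) := add_le_add (hf x) (hg x)
    _ ≤ K * Real.exp ((K + L) * ‖x‖) + L * Real.exp ((K + L) * ‖x‖) := by gcongr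
    _ = _ := by ring

lemma mul {f g : E → ℝ} (hf : ExpB f) (hg : ExpB g) : ExpB (fun x => f x * g x) := by
  obtain ⟨K, hK, hf⟩ := hf
  obtain ⟨L, hL, hg⟩ := hg
  refine ⟨(K + L) + K * L, by positivity, fun x => ?_⟩
  have h1 : Real.exp ((K + L) * ‖x‖) ≤ Real.exp ((K + L + K * L) * ‖x‖) := by
    refine Real.exp_le_exp.2 (mul_le_mul_of_nonneg_right ?_ (norm_nonneg _))
    nlinarith [mul_nonneg hK hL]
  calc |f x * g x| = |f x| * |g x| := abs_mul _ _
    _ ≤ (K * Real.exp (K * ‖x‖)) * (L * Real.exp (L * ‖x‖)) := by gcongr; exacts [hf x, hg x]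
    _ = (K * L) * Real.exp ((K + L) * ‖x‖) := by rw [add_mul, Real.exp_add]; ring
    _ ≤ (K + L + K * L) * Real.exp ((K + L + K * L) * ‖x‖) :=
        mul_le_mul (by linarith) h1 (Real.exp_pos _).le (by positivity)

lemma comp {F : Type*} [NormedAddCommGroup F] {f : E → ℝ} (hf : ExpB f) (T : F → E) (a b : ℝ)
    (hT : ∀ x, ‖T x‖ ≤ a * ‖x‖ + b) : ExpB (fun x => f (T x)) := by
  obtain ⟨K, hK, hf⟩ := hf
  refine ((const (K * Real.exp (K * b))).mul (exp_norm (K * a))).mono fun x => (hf _).trans ?_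
  rw [mul_assoc, ← Real.exp_add]
  gcongr
  nlinarith [hT x]

lemma integrable [NormedSpace ℝ E] [CompleteSpace E] [SecondCountableTopology E]
    [MeasurableSpace E] [BorelSpace E] {f : E → ℝ} (hf : ExpB f) (hc : Continuous f)
    (μ : Measure E) [IsGaussian μ] : Integrable f μ := by
  obtain ⟨K, hK, hf⟩ := hf
  obtain ⟨C, hC, hi⟩ := IsGaussian.exists_integrable_exp_sq μ
  refine (hi.const_mul (K * Real.exp (K ^ 2 / (4 * C)))).mono' hc.aestronglyMeasurable
    (ae_of_all _ fun x => (hf x).trans ?_)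
  rw [mul_assoc, ← Real.exp_add]
  gcongr
  have : K ^ 2 / (4 * C) + C * ‖x‖ ^ 2 - K * ‖x‖ = (K - 2 * C * ‖x‖) ^ 2 / (4 * C) := by
    field_simp; ring
  have : 0 ≤ (K - 2 * C * ‖x‖) ^ 2 / (4 * C) := by positivity
  linarith

end ExpB

lemma integrable_comp_gauss {Ω' : Type*} [MeasurableSpace Ω'] {μ : Measure Ω'}
    {E : Type*} [NormedAddCommGroup E] [NormedSpace ℝ E] [CompleteSpace E]
    [SecondCountableTopology E] [MeasurableSpace E] [BorelSpace E] {X : Ω' → E}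
    (hX : HasGaussianLaw X μ) {f : E → ℝ} (hf : ExpB f) (hc : Continuous f) :
    Integrable (fun ω => f (X ω)) μ := by
  have := hX.isGaussian_map
  exact (integrable_map_measure hc.aestronglyMeasurable hX.aemeasurable).1
    (hf.integrable hc (μ.map X))

lemma hasDerivAt_gaussianPDF (v : ℝ≥0) (hv : v ≠ 0) (x : ℝ) :
    HasDerivAt (gaussianPDFReal 0 v) (-(x / v) * gaussianPDFReal 0 v x) x := by
  have hv' : (v : ℝ) ≠ 0 := by exact_mod_cast hv
  have h : HasDerivAt (fun x : ℝ => -(x - 0) ^ 2 / (2 * (v : ℝ))) (-(x / v)) x := by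
    have := (((hasDerivAt_pow 2 x)).neg).div_const (2 * (v : ℝ))
    simp only [sub_zero]
    refine this.congr_deriv ?_
    field_simp; simp
  rw [gaussianPDFReal_def]
  refine (h.exp.const_mul ((Real.sqrt (2 * Real.pi * v))⁻¹)).congr_deriv ?_
  ring

lemma stein_one (v : ℝ≥0) (f f' : ℝ → ℝ) (hd : ∀ x, HasDerivAt f (f' x) x)
    (h1 : Integrable f (gaussianReal 0 v)) (h2 : Integrable f' (gaussianReal 0 v))
    (h3 : Integrable (fun x => x * f x) (gaussianReal 0 v)) :
    ∫ x, x * f x ∂(gaussianReal 0 v) = v * ∫ x, f' x ∂(gaussianReal 0 v) := by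
  by_cases hv : v = 0
  · subst hv; simp
  have hv' : (v : ℝ) ≠ 0 := by exact_mod_cast hv
  have key : ∀ g : ℝ → ℝ, Integrable g (gaussianReal 0 v) →
      Integrable (fun x => g x * gaussianPDFReal 0 v x) := by
    intro g hg
    rw [gaussianReal_of_var_ne_zero _ hv, integrable_withDensity_iff (measurable_gaussianPDF _ _)
      (ae_of_all _ fun x => gaussianPDF_lt_top)] at hg
    simpa using hg
  rw [integral_gaussianReal_eq_integral_smul hv, integral_gaussianReal_eq_integral_smul hv]
  have := integral_mul_deriv_eq_deriv_mul_of_integrable (u := f) (u' := f')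
    (v := gaussianPDFReal 0 v) (v' := fun x => -(x / v) * gaussianPDFReal 0 v x)
    (fun x _ => hd x) (fun x _ => hasDerivAt_gaussianPDF v hv x) ?_ (key _ h2) (key _ h1)
  · have e : ∀ x, gaussianPDFReal 0 v x • (x * f x) =
        -v * (f x * (-(x / v) * gaussianPDFReal 0 v x)) := by
      intro x; simp only [smul_eq_mul]; field_simp
    simp_rw [e]
    rw [integral_const_mul, this]
    simp_rw [smul_eq_mul, mul_comm (gaussianPDFReal 0 v _)]
    ring
  · refine ((key _ h3).const_mul (-(1 / (v : ℝ)))).congr (ae_of_all _ fun x => ?_)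
    simp only [Pi.mul_apply]; field_simp

lemma stein_vec {Ω' : Type*} [MeasurableSpace Ω'] {μ : Measure Ω'} [IsProbabilityMeasure μ]
    {ι : Type*} [Fintype ι] (U : Ω' → ℝ) (X : Ω' → ι → ℝ)
    (hG : HasGaussianLaw (fun ω => (U ω, X ω)) μ) (hU : ∫ ω, U ω ∂μ = 0)
    (h : (ι → ℝ) → ℝ) (Dh : ι → (ι → ℝ) → ℝ) (hc : Continuous h) (hDc : ∀ j, Continuous (Dh j))
    (hb : ExpB h) (hDb : ∀ j, ExpB (Dh j))
    (hd : ∀ (x c : ι → ℝ) (s : ℝ), HasDerivAt (fun s => h (x + s • c))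
      (∑ j, c j * Dh j (x + s • c)) s) :
    ∫ ω, U ω * h (X ω) ∂μ = ∑ j, cov[U, fun ω => X ω j; μ] * ∫ ω, Dh j (X ω) ∂μ := by
  have hUG : HasGaussianLaw U μ := hG.fst
  have hXG : HasGaussianLaw X μ := hG.snd
  have hXj : ∀ j, HasGaussianLaw (fun ω => X ω j) μ := fun j =>
    hXG.map_fun (ContinuousLinearMap.proj (R := ℝ) (φ := fun _ : ι => ℝ) j)
  set v : ℝ≥0 := Var[U; μ].toNNReal with hv
  have hvv : (v : ℝ) = Var[U; μ] := Real.coe_toNNReal _ (variance_nonneg _ _)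
  have hlawU : μ.map U = gaussianReal 0 v := by rw [hUG.map_eq_gaussianReal, hU]
  set c : ι → ℝ := fun j => cov[U, fun ω => X ω j; μ] / v with hcdef
  have hcv : ∀ j, c j * v = cov[U, fun ω => X ω j; μ] := by
    intro j
    by_cases h0 : (v : ℝ) = 0
    · have h1 : Var[U; μ] = 0 := by rw [← hvv, h0]
      have h2 : U =ᵐ[μ] fun _ => 0 := by
        have := ae_eq_integral_of_variance_eq_zero hUG.memLp_two h1
        rw [hU] at this
        exact this
      have h3 : cov[U, fun ω => X ω j; μ] = 0 := by
        unfold covariance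
        rw [hU]
        rw [integral_congr_ae (g := fun _ => (0:ℝ))]
        · simp
        · filter_upwards [h2] with ω hω
          rw [hω]; simp
      rw [h3, h0, mul_zero]
    · simp only [hcdef]; field_simp
  set R : Ω' → ι → ℝ := fun ω j => X ω j - c j * U ω with hR
  have hUR : HasGaussianLaw (fun ω => (U ω, R ω)) μ := by
    let A : (ℝ × (ι → ℝ)) →L[ℝ] (ℝ × (ι → ℝ)) :=
      (ContinuousLinearMap.fst ℝ ℝ (ι → ℝ)).prod
        (ContinuousLinearMap.snd ℝ ℝ (ι → ℝ) -
          (ContinuousLinearMap.fst ℝ ℝ (ι → ℝ)).smulRight c)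
    have := hG.map_fun A
    have e : (fun ω => (U ω, R ω)) = fun ω => A (U ω, X ω) := by
      funext ω
      refine Prod.ext rfl ?_
      funext j
      simp [A, hR, mul_comm]
    rw [e]; exact this
  have hind : IndepFun U R μ := by
    have hUR' : HasGaussianLaw (fun ω => ((fun _ : Unit => U ω), R ω)) μ := by
      let A : (ℝ × (ι → ℝ)) →L[ℝ] ((Unit → ℝ) × (ι → ℝ)) :=
        (ContinuousLinearMap.pi fun _ => ContinuousLinearMap.fst ℝ ℝ (ι → ℝ)).prod
          (ContinuousLinearMap.snd ℝ ℝ (ι → ℝ))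
      exact hUR.map_fun A
    have := HasGaussianLaw.indepFun_of_covariance_eval (X := fun (_ : Unit) ω => U ω)
      (Y := fun j ω => R ω j) hUR' (fun _ j => by
        have e : cov[U, fun ω => X ω j - c j * U ω; μ] = 0 := by
          rw [covariance_fun_sub_right hUG.memLp_two (hXj j).memLp_two
            (hUG.memLp_two.const_mul _), covariance_const_mul_right,
            covariance_self hUG.aemeasurable, ← hvv, hcv, sub_self]
        exact e)
    exact this.comp (φ := fun f : Unit → ℝ => f ()) (ψ := id) (measurable_pi_apply _) measurable_id
  have hlaw : μ.map (fun ω => (U ω, R ω)) = (gaussianReal 0 v).prod (μ.map R) := by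
    rw [(indepFun_iff_map_prod_eq_prod_map_map hUG.aemeasurable hUR.snd.aemeasurable).1 hind, hlawU]
  have : IsGaussian (μ.map R) := hUR.snd.isGaussian_map
  have hXe : ∀ ω, X ω = R ω + U ω • c := by
    intro ω; ext j; simp [hR]; ring
  let T : ℝ × (ι → ℝ) → (ι → ℝ) := fun z => z.2 + z.1 • c
  have hTc : Continuous T := by fun_prop
  have hTb : ∀ z, ‖T z‖ ≤ (1 + ‖c‖) * ‖z‖ + 0 := by
    intro z
    calc ‖T z‖ ≤ ‖z.2‖ + ‖z.1 • c‖ := norm_add_le _ _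
      _ = ‖z.2‖ + ‖z.1‖ * ‖c‖ := by rw [norm_smul]
      _ ≤ ‖z‖ + ‖z‖ * ‖c‖ := by gcongr; exacts [norm_snd_le z, norm_fst_le z]
      _ = _ := by ring
  have transfer : ∀ g : ℝ × (ι → ℝ) → ℝ, Continuous g →
      ∫ ω, g (U ω, R ω) ∂μ = ∫ z, g z ∂((gaussianReal 0 v).prod (μ.map R)) := by
    intro g hg
    rw [← hlaw, integral_map hUR.aemeasurable hg.aestronglyMeasurable]
  have i1 : ExpB (fun z : ℝ × (ι → ℝ) => h (T z)) := hb.comp T _ _ hTb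
  have i2 : ∀ j, ExpB (fun z : ℝ × (ι → ℝ) => Dh j (T z)) := fun j => (hDb j).comp T _ _ hTb
  have i0 : ExpB (fun z : ℝ × (ι → ℝ) => z.1) := ExpB.norm.mono fun z => norm_fst_le z
  have j1 := i1.integrable (by fun_prop) ((gaussianReal 0 v).prod (μ.map R))
  have j2 := fun j => (i2 j).integrable (by fun_prop) ((gaussianReal 0 v).prod (μ.map R))
  have j3 := (i0.mul i1).integrable (by fun_prop) ((gaussianReal 0 v).prod (μ.map R))
  have j4 : Integrable (fun z : ℝ × (ι → ℝ) => ∑ j, c j * Dh j (T z))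
      ((gaussianReal 0 v).prod (μ.map R)) :=
    integrable_finsetSum _ fun j _ => (j2 j).const_mul _
  have e1 : ∫ ω, U ω * h (X ω) ∂μ =
      ∫ z, z.1 * h (T z) ∂((gaussianReal 0 v).prod (μ.map R)) := by
    rw [← transfer (fun z => z.1 * h (T z)) (by fun_prop)]
    simp_rw [hXe]; rfl
  have e2 : ∀ j, ∫ ω, Dh j (X ω) ∂μ =
      ∫ z, Dh j (T z) ∂((gaussianReal 0 v).prod (μ.map R)) := by
    intro j
    rw [← transfer (fun z => Dh j (T z)) (by fun_prop)]
    simp_rw [hXe]; rfl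
  have e3 : ∫ z, z.1 * h (T z) ∂((gaussianReal 0 v).prod (μ.map R)) =
      v * ∫ z, ∑ j, c j * Dh j (T z) ∂((gaussianReal 0 v).prod (μ.map R)) := by
    rw [integral_prod_symm _ j3, integral_prod_symm _ j4, ← integral_const_mul]
    refine integral_congr_ae ?_
    filter_upwards [j1.prod_left_ae, j3.prod_left_ae, j4.prod_left_ae] with r h1 h3 h4
    exact stein_one v (fun u => h (r + u • c)) (fun u => ∑ j, c j * Dh j (r + u • c))
      (fun u => hd r c u) h1 h4 h3
  rw [e1, e3, integral_finsetSum _ (fun j _ => (j2 j).const_mul _), Finset.mul_sum]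
  refine Finset.sum_congr rfl fun j _ => ?_
  rw [integral_const_mul, e2, ← hcv]
  ring

section LSE
variable {ι : Type*} [Fintype ι]

/-- sum of exponentials -/
noncomputable def lS (p : ℝ) (y : ι → ℝ) : ℝ := ∑ i, Real.exp (p * y i)
/-- smooth version of the maximum of the exponentials -/
noncomputable def lH (p : ℝ) (y : ι → ℝ) : ℝ := Real.exp (Real.log (lS p y) / p)
/-- soft-max weights -/
noncomputable def lW (p : ℝ) (i : ι) (y : ι → ℝ) : ℝ := Real.exp (p * y i) / lS p y

lemma lS_pos [Nonempty ι] (p : ℝ) (y : ι → ℝ) : 0 < lS p y :=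
  Finset.sum_pos (fun i _ => Real.exp_pos _) Finset.univ_nonempty

lemma lS_cont (p : ℝ) : Continuous (lS p : (ι → ℝ) → ℝ) := by unfold lS; fun_prop

lemma lH_cont [Nonempty ι] (p : ℝ) : Continuous (lH p : (ι → ℝ) → ℝ) := by
  unfold lH
  have := lS_cont (ι := ι) p
  have h : Continuous fun y : ι → ℝ => Real.log (lS p y) :=
    this.log fun y => (lS_pos p y).ne'
  fun_prop

lemma lW_cont [Nonempty ι] (p : ℝ) (i : ι) : Continuous (lW p i : (ι → ℝ) → ℝ) := by
  unfold lW
  exact Continuous.div (by fun_prop) (lS_cont p) fun y => (lS_pos p y).ne'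

lemma lH_pos (p : ℝ) (y : ι → ℝ) : 0 < lH p y := Real.exp_pos _

lemma lW_nonneg [Nonempty ι] (p : ℝ) (i : ι) (y : ι → ℝ) : 0 ≤ lW p i y :=
  div_nonneg (Real.exp_pos _).le (lS_pos p y).le

lemma lW_sum [Nonempty ι] (p : ℝ) (y : ι → ℝ) : ∑ i, lW p i y = 1 := by
  unfold lW
  rw [← Finset.sum_div]
  exact div_self (lS_pos p y).ne'

lemma lW_le_one [Nonempty ι] (p : ℝ) (i : ι) (y : ι → ℝ) : lW p i y ≤ 1 := by
  rw [← lW_sum p y]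
  exact Finset.single_le_sum (f := fun i => lW p i y) (fun j _ => lW_nonneg p j y)
    (Finset.mem_univ i)

lemma lH_le_of [Nonempty ι] {p : ℝ} (hp : 0 < p) (y : ι → ℝ) (M : ℝ) (hM : ∀ i, y i ≤ M) :
    lH p y ≤ Real.exp (Real.log (Fintype.card ι) / p) * Real.exp M := by
  unfold lH
  rw [← Real.exp_add]
  refine Real.exp_le_exp.2 ?_
  have hN : (0:ℝ) < Fintype.card ι := by exact_mod_cast Fintype.card_pos
  have h1 : lS p y ≤ Fintype.card ι * Real.exp (p * M) := by
    unfold lS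
    calc _ ≤ ∑ i : ι, Real.exp (p * M) := by gcongr with i; exact hM i
      _ = _ := by simp
  have h2 : Real.log (lS p y) ≤ Real.log (Fintype.card ι) + p * M := by
    rw [← Real.log_exp (p * M), ← Real.log_mul hN.ne' (Real.exp_pos _).ne']
    exact Real.log_le_log (lS_pos p y) h1
  rw [div_add' _ _ _ hp.ne']
  gcongr
  linarith

lemma exp_le_lH [Nonempty ι] {p : ℝ} (hp : 0 < p) (y : ι → ℝ) (i : ι) :
    Real.exp (y i) ≤ lH p y := by
  unfold lH
  refine Real.exp_le_exp.2 ?_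
  rw [le_div_iff₀ hp, Real.le_log_iff_exp_le (lS_pos p y), mul_comm]
  exact Finset.single_le_sum (f := fun i => Real.exp (p * y i)) (fun j _ => (Real.exp_pos _).le)
    (Finset.mem_univ i)

lemma lH_bd [Nonempty ι] {p : ℝ} (hp : 0 < p) (y : ι → ℝ) :
    lH p y ≤ Real.exp (Real.log (Fintype.card ι) / p) * Real.exp ‖y‖ :=
  lH_le_of hp y _ fun i => (le_abs_self _).trans (norm_le_pi_norm y i)

lemma lH_expB [Nonempty ι] {p : ℝ} (hp : 0 < p) : ExpB (lH p : (ι → ℝ) → ℝ) := by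
  refine ((ExpB.const (Real.exp (Real.log (Fintype.card ι) / p))).mul (ExpB.exp_norm 1)).mono
    fun y => ?_
  rw [abs_of_pos (lH_pos p y), one_mul]
  exact lH_bd hp y

lemma lS_deriv (p : ℝ) (y : ℝ → ι → ℝ) (y' : ι → ℝ) (s : ℝ)
    (hy : ∀ j, HasDerivAt (fun s => y s j) (y' j) s) :
    HasDerivAt (fun s => lS p (y s)) (∑ j, p * (Real.exp (p * y s j) * y' j)) s := by
  unfold lS
  refine HasDerivAt.fun_sum fun j _ => ?_
  refine (((hy j).const_mul p).exp).congr_deriv ?_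
  ring

lemma lH_deriv [Nonempty ι] {p : ℝ} (hp : 0 < p) (y : ℝ → ι → ℝ) (y' : ι → ℝ) (s : ℝ)
    (hy : ∀ j, HasDerivAt (fun s => y s j) (y' j) s) :
    HasDerivAt (fun s => lH p (y s)) (lH p (y s) * ∑ j, lW p j (y s) * y' j) s := by
  have h := (((lS_deriv p y y' s hy).log (lS_pos p (y s)).ne').div_const p).exp
  refine h.congr_deriv ?_
  have := (lS_pos p (y s)).ne'
  unfold lH
  congr 1
  rw [← Finset.mul_sum]
  unfold lW
  simp_rw [div_mul_eq_mul_div]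
  rw [← Finset.sum_div]
  field_simp

lemma lG_deriv [Nonempty ι] {p : ℝ} (hp : 0 < p) (i : ι) (y : ℝ → ι → ℝ) (y' : ι → ℝ) (s : ℝ)
    (hy : ∀ j, HasDerivAt (fun s => y s j) (y' j) s) :
    HasDerivAt (fun s => lH p (y s) * lW p i (y s))
      (lH p (y s) * lW p i (y s) * ((1 - p) * ∑ j, lW p j (y s) * y' j + p * y' i)) s := by
  have hW : HasDerivAt (fun s => lW p i (y s))
      (p * lW p i (y s) * (y' i - ∑ j, lW p j (y s) * y' j)) s := by
    have h := (((hy i).const_mul p).exp).fun_div (lS_deriv p y y' s hy) (lS_pos p (y s)).ne'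
    refine h.congr_deriv ?_
    have := (lS_pos p (y s)).ne'
    rw [← Finset.mul_sum]
    unfold lW
    simp_rw [div_mul_eq_mul_div]
    rw [← Finset.sum_div]
    field_simp
  refine ((lH_deriv hp y y' s hy).fun_mul hW).congr_deriv ?_
  ring

lemma quad_ineq (w : ι → ℝ) (hw : ∀ i, 0 ≤ w i) (h1 : ∑ i, w i = 1) (D : ι → ι → ℝ)
    (hD : ∀ i j, 0 ≤ D i i + D j j - 2 * D i j) :
    ∑ i, ∑ j, w i * w j * D i j ≤ ∑ i, w i * D i i := by
  have h : 0 ≤ ∑ i, ∑ j, w i * w j * (D i i + D j j - 2 * D i j) :=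
    Finset.sum_nonneg fun i _ => Finset.sum_nonneg fun j _ =>
      mul_nonneg (mul_nonneg (hw i) (hw j)) (hD i j)
  have e1 : ∑ i, ∑ j, w i * w j * D i i = ∑ i, w i * D i i := by
    refine Finset.sum_congr rfl fun i _ => ?_
    calc ∑ j, w i * w j * D i i = (∑ j, w j) * (w i * D i i) := by
          rw [Finset.sum_mul]; exact Finset.sum_congr rfl fun j _ => by ring
      _ = _ := by rw [h1, one_mul]
  have e2 : ∑ i, ∑ j, w i * w j * D j j = ∑ i, w i * D i i := by
    rw [Finset.sum_comm, ← e1]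
    exact Finset.sum_congr rfl fun i _ => Finset.sum_congr rfl fun j _ => by ring
  have e3 : ∑ i, ∑ j, w i * w j * (D i i + D j j - 2 * D i j) =
      ∑ i, ∑ j, w i * w j * D i i + ∑ i, ∑ j, w i * w j * D j j
        - 2 * ∑ i, ∑ j, w i * w j * D i j := by
    simp_rw [Finset.mul_sum, ← Finset.sum_add_distrib, ← Finset.sum_sub_distrib]
    exact Finset.sum_congr rfl fun i _ => Finset.sum_congr rfl fun j _ => by ring
  rw [e3, e1, e2] at h
  linarith

/-- partial derivatives of `lH * lW i` -/
noncomputable def lD [DecidableEq ι] (p : ℝ) (i j : ι) (y : ι → ℝ) : ℝ :=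
  lH p y * lW p i y * ((1 - p) * lW p j y + p * (if j = i then 1 else 0))

lemma lD_quad [Nonempty ι] [DecidableEq ι] {p : ℝ} (hp : 1 ≤ p) (D : ι → ι → ℝ)
    (hD : ∀ i j, 0 ≤ D i i + D j j - 2 * D i j) (y : ι → ℝ) :
    0 ≤ ∑ i, (∑ j, D i j * lD p i j y - D i i * (lH p y * lW p i y)) := by
  have hq := quad_ineq (fun i => lW p i y) (fun i => lW_nonneg p i y) (lW_sum p y) D hD
  have e : ∑ i, (∑ j, D i j * lD p i j y - D i i * (lH p y * lW p i y)) =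
      (p - 1) * lH p y * (∑ i, lW p i y * D i i - ∑ i, ∑ j, lW p i y * lW p j y * D i j) := by
    rw [← Finset.sum_sub_distrib, Finset.mul_sum]
    refine Finset.sum_congr rfl fun i _ => ?_
    have : ∑ j, D i j * lD p i j y =
        (1 - p) * lH p y * (∑ j, lW p i y * lW p j y * D i j) + p * lH p y * lW p i y * D i i := by
      have h2 : p * lH p y * lW p i y * D i i =
          ∑ j, p * lH p y * lW p i y * (if j = i then 1 else 0) * D i j := by simp
      rw [h2, Finset.mul_sum, ← Finset.sum_add_distrib]
      refine Finset.sum_congr rfl fun j _ => ?_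
      unfold lD
      ring
    rw [this]; ring
  rw [e]
  exact mul_nonneg (mul_nonneg (by linarith) (lH_pos p y).le) (by linarith)

lemma lD_cont [Nonempty ι] [DecidableEq ι] (p : ℝ) (i j : ι) : Continuous (lD p i j) := by
  unfold lD
  have := lH_cont (ι := ι) p
  have := lW_cont (ι := ι) p
  fun_prop

lemma lW_expB [Nonempty ι] (p : ℝ) (i : ι) : ExpB (lW p i) :=
  (ExpB.const 1).mono fun y => by
    rw [abs_of_nonneg (lW_nonneg p i y)]; exact lW_le_one p i y

lemma lD_expB [Nonempty ι] [DecidableEq ι] {p : ℝ} (hp : 0 < p) (i j : ι) : ExpB (lD p i j) := by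
  unfold lD
  exact ((lH_expB hp).mul (lW_expB p i)).mul
    (((ExpB.const (1 - p)).mul (lW_expB p j)).add (ExpB.const _))

end LSE

section Interp
variable {ι : Type*} [Fintype ι]

/-- interpolated field -/
noncomputable def iX (θ : ℝ) (z : (ι → ℝ) × (ι → ℝ)) : ι → ℝ :=
  fun j => Real.cos θ * z.2 j + Real.sin θ * z.1 j
/-- centering -/
noncomputable def iM (c₁ c₂ : ι → ℝ) (θ : ℝ) : ι → ℝ :=
  fun j => (Real.cos θ ^ 2 * c₂ j + Real.sin θ ^ 2 * c₁ j) / 2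
/-- derivative of the interpolated field -/
noncomputable def iU (θ : ℝ) (z : (ι → ℝ) × (ι → ℝ)) : ι → ℝ :=
  fun j => -Real.sin θ * z.2 j + Real.cos θ * z.1 j

lemma iX_norm (θ : ℝ) (z : (ι → ℝ) × (ι → ℝ)) : ‖iX θ z‖ ≤ 2 * ‖z‖ + 0 := by
  rw [pi_norm_le_iff_of_nonneg (by positivity)]
  intro j
  have h1 : |z.1 j| ≤ ‖z‖ := (norm_le_pi_norm z.1 j).trans (norm_fst_le z)
  have h2 : |z.2 j| ≤ ‖z‖ := (norm_le_pi_norm z.2 j).trans (norm_snd_le z)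
  have h3 := Real.abs_cos_le_one θ
  have h4 := Real.abs_sin_le_one θ
  calc |Real.cos θ * z.2 j + Real.sin θ * z.1 j|
      ≤ |Real.cos θ| * |z.2 j| + |Real.sin θ| * |z.1 j| := by
        rw [← abs_mul, ← abs_mul]; exact abs_add_le _ _
    _ ≤ 1 * ‖z‖ + 1 * ‖z‖ := by gcongr
    _ = _ := by ring

lemma iU_bd (θ : ℝ) (z : (ι → ℝ) × (ι → ℝ)) (j : ι) : |iU θ z j| ≤ 2 * ‖z‖ := by
  have h1 : |z.1 j| ≤ ‖z‖ := (norm_le_pi_norm z.1 j).trans (norm_fst_le z)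
  have h2 : |z.2 j| ≤ ‖z‖ := (norm_le_pi_norm z.2 j).trans (norm_snd_le z)
  have h3 := Real.abs_cos_le_one θ
  have h4 := Real.abs_sin_le_one θ
  calc |-Real.sin θ * z.2 j + Real.cos θ * z.1 j|
      ≤ |Real.sin θ| * |z.2 j| + |Real.cos θ| * |z.1 j| := by
        rw [← abs_neg (Real.sin θ), ← abs_mul, ← abs_mul]; exact abs_add_le _ _
    _ ≤ 1 * ‖z‖ + 1 * ‖z‖ := by gcongr
    _ = _ := by ring

lemma iM_norm (c₁ c₂ : ι → ℝ) (θ : ℝ) : ‖iM c₁ c₂ θ‖ ≤ ‖c₁‖ + ‖c₂‖ := by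
  rw [pi_norm_le_iff_of_nonneg (by positivity)]
  intro j
  have h1 : |c₁ j| ≤ ‖c₁‖ := norm_le_pi_norm c₁ j
  have h2 : |c₂ j| ≤ ‖c₂‖ := norm_le_pi_norm c₂ j
  have h3 : |Real.cos θ ^ 2| ≤ 1 := by
    rw [abs_of_nonneg (sq_nonneg _)]; exact Real.cos_sq_le_one θ
  have h4 : |Real.sin θ ^ 2| ≤ 1 := by
    rw [abs_of_nonneg (sq_nonneg _)]; exact Real.sin_sq_le_one θ
  calc |(Real.cos θ ^ 2 * c₂ j + Real.sin θ ^ 2 * c₁ j) / 2|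
      ≤ (|Real.cos θ ^ 2| * |c₂ j| + |Real.sin θ ^ 2| * |c₁ j|) / 2 := by
        rw [← abs_mul, ← abs_mul, abs_div, abs_two]; gcongr; exact abs_add_le _ _
    _ ≤ (1 * ‖c₂‖ + 1 * ‖c₁‖) / 2 := by gcongr
    _ ≤ _ := by linarith [norm_nonneg c₁, norm_nonneg c₂]

lemma iX_cont (θ : ℝ) : Continuous (iX θ : (ι → ℝ) × (ι → ℝ) → ι → ℝ) := by
  unfold iX; fun_prop

lemma iU_cont (θ : ℝ) (j : ι) : Continuous (fun z : (ι → ℝ) × (ι → ℝ) => iU θ z j) := by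
  unfold iU; fun_prop

lemma iZ_deriv (c₁ c₂ : ι → ℝ) (z : (ι → ℝ) × (ι → ℝ)) (θ : ℝ) (j : ι) :
    HasDerivAt (fun θ => (iX θ z - iM c₁ c₂ θ) j)
      (iU θ z j - Real.sin θ * Real.cos θ * (c₁ j - c₂ j)) θ := by
  have hc := Real.hasDerivAt_cos θ
  have hs := Real.hasDerivAt_sin θ
  have h := ((hc.mul_const (z.2 j)).fun_add (hs.mul_const (z.1 j))).fun_sub
    ((((hc.fun_pow 2).mul_const (c₂ j)).fun_add ((hs.fun_pow 2).mul_const (c₁ j))).div_const 2)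
  simp only [Pi.sub_apply, iX, iM, iU]
  refine h.congr_deriv ?_
  simp
  ring

lemma phi_deriv [Nonempty ι] {p : ℝ} (hp : 0 < p) (μ : Measure ((ι → ℝ) × (ι → ℝ))) [IsGaussian μ]
    (c₁ c₂ : ι → ℝ) (θ : ℝ) :
    HasDerivAt (fun θ => ∫ z, lH p (iX θ z - iM c₁ c₂ θ) ∂μ)
      (∫ z, lH p (iX θ z - iM c₁ c₂ θ) * ∑ j, lW p j (iX θ z - iM c₁ c₂ θ) *
        (iU θ z j - Real.sin θ * Real.cos θ * (c₁ j - c₂ j)) ∂μ) θ := by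
  set B : ℝ := ‖c₁‖ + ‖c₂‖ with hB
  have hB0 : 0 ≤ B := by positivity
  set N : ℝ := Real.exp (Real.log (Fintype.card ι) / p) with hN
  have hHc := lH_cont (ι := ι) p
  have hWc := lW_cont (ι := ι) p
  have hZn : ∀ θ (z : (ι → ℝ) × (ι → ℝ)), ‖iX θ z - iM c₁ c₂ θ‖ ≤ 2 * ‖z‖ + B := by
    intro θ z
    refine (norm_sub_le _ _).trans ?_
    linarith [iX_norm θ z, iM_norm c₁ c₂ θ]
  have hFc : ∀ θ, Continuous fun z : (ι → ℝ) × (ι → ℝ) => lH p (iX θ z - iM c₁ c₂ θ) := by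
    intro θ
    have := iX_cont (ι := ι) θ
    fun_prop
  refine (hasDerivAt_integral_of_dominated_loc_of_deriv_le (s := Set.univ) (μ := μ) (x₀ := θ)
    (F := fun θ z => lH p (iX θ z - iM c₁ c₂ θ))
    (F' := fun θ z => lH p (iX θ z - iM c₁ c₂ θ) * ∑ j, lW p j (iX θ z - iM c₁ c₂ θ) *
        (iU θ z j - Real.sin θ * Real.cos θ * (c₁ j - c₂ j)))
    (bound := fun z => (N * Real.exp B) * Real.exp (2 * ‖z‖) * ((2 : ℝ) * ‖z‖ + B))
    Filter.univ_mem
    (Eventually.of_forall fun θ => (hFc θ).aestronglyMeasurable) ?_ ?_ ?_ ?_ ?_).2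
  · exact ((lH_expB hp).comp _ 2 B (hZn θ)).integrable (hFc θ) μ
  · have := iX_cont (ι := ι) θ
    have := iU_cont (ι := ι) θ
    have : Continuous fun z : (ι → ℝ) × (ι → ℝ) =>
      lH p (iX θ z - iM c₁ c₂ θ) * ∑ j, lW p j (iX θ z - iM c₁ c₂ θ) *
        (iU θ z j - Real.sin θ * Real.cos θ * (c₁ j - c₂ j)) := by fun_prop
    exact this.aestronglyMeasurable
  · refine ae_of_all _ fun z θ _ => ?_
    rw [Real.norm_eq_abs, abs_mul, abs_of_pos (lH_pos _ _)]
    have h1 : lH p (iX θ z - iM c₁ c₂ θ) ≤ (N * Real.exp B) * Real.exp (2 * ‖z‖) := by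
      refine (lH_bd hp _).trans ?_
      have hh : Real.exp ‖iX θ z - iM c₁ c₂ θ‖ ≤ Real.exp B * Real.exp (2 * ‖z‖) := by
        rw [← Real.exp_add]
        exact Real.exp_le_exp.2 (by linarith [hZn θ z])
      rw [mul_assoc]
      exact mul_le_mul_of_nonneg_left hh (Real.exp_nonneg _)
    refine mul_le_mul h1 ?_ (abs_nonneg _) (by positivity)
    calc _ ≤ ∑ j, |lW p j (iX θ z - iM c₁ c₂ θ) *
            (iU θ z j - Real.sin θ * Real.cos θ * (c₁ j - c₂ j))| := Finset.abs_sum_le_sum_abs _ _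
      _ ≤ ∑ j, lW p j (iX θ z - iM c₁ c₂ θ) * (2 * ‖z‖ + B) := by
          refine Finset.sum_le_sum fun j _ => ?_
          rw [abs_mul, abs_of_nonneg (lW_nonneg _ _ _)]
          refine mul_le_mul_of_nonneg_left ?_ (lW_nonneg _ _ _)
          have a1 : |c₁ j| ≤ ‖c₁‖ := norm_le_pi_norm c₁ j
          have a2 : |c₂ j| ≤ ‖c₂‖ := norm_le_pi_norm c₂ j
          have a3 : |Real.sin θ * Real.cos θ * (c₁ j - c₂ j)| ≤ 1 * 1 * (‖c₁‖ + ‖c₂‖) := by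
            rw [abs_mul, abs_mul]
            gcongr
            · exact Real.abs_sin_le_one θ
            · exact Real.abs_cos_le_one θ
            · exact (abs_sub _ _).trans (add_le_add a1 a2)
          refine (abs_sub _ _).trans ?_
          linarith [iU_bd θ z j]
      _ = _ := by rw [← Finset.sum_mul, lW_sum, one_mul]
  · refine ExpB.integrable ?_ (by fun_prop) μ
    exact ((ExpB.const _).mul (ExpB.exp_norm 2)).mul
      (((ExpB.const 2).mul ExpB.norm).add (ExpB.const B))
  · exact ae_of_all _ fun z θ _ =>
      lH_deriv hp (fun θ => iX θ z - iM c₁ c₂ θ) _ θ (iZ_deriv c₁ c₂ z θ)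

lemma phi_deriv_nonneg [Nonempty ι] {p : ℝ} (hp : 1 ≤ p) (μ : Measure ((ι → ℝ) × (ι → ℝ)))
    [IsGaussian μ] (C₁ C₂ : ι → ι → ℝ)
    (m1 : ∀ i, ∫ z, z.1 i ∂μ = 0) (m2 : ∀ i, ∫ z, z.2 i ∂μ = 0)
    (h11 : ∀ i j, cov[fun z => z.1 i, fun z => z.1 j; μ] = C₁ i j)
    (h22 : ∀ i j, cov[fun z => z.2 i, fun z => z.2 j; μ] = C₂ i j)
    (h12 : ∀ i j, cov[fun z => z.1 i, fun z => z.2 j; μ] = 0)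
    (hC : ∀ i j, C₂ i i + C₂ j j - 2 * C₂ i j ≤ C₁ i i + C₁ j j - 2 * C₁ i j)
    (θ : ℝ) (hs : 0 ≤ Real.sin θ) (hc : 0 ≤ Real.cos θ) :
    0 ≤ ∫ z, lH p (iX θ z - iM (fun i => C₁ i i) (fun i => C₂ i i) θ) *
        ∑ j, lW p j (iX θ z - iM (fun i => C₁ i i) (fun i => C₂ i i) θ) *
        (iU θ z j - Real.sin θ * Real.cos θ * (C₁ j j - C₂ j j)) ∂μ := by
  classical
  have hp0 : 0 < p := by linarith
  set m : ι → ℝ := iM (fun i => C₁ i i) (fun i => C₂ i i) θ with hm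
  have hHc := lH_cont (ι := ι) p
  have hWc := lW_cont (ι := ι) p
  have hDc := lD_cont (ι := ι) p
  have hXc := iX_cont (ι := ι) θ
  have hUc := iU_cont (ι := ι) θ
  have g1 : ∀ i, HasGaussianLaw (fun z : (ι → ℝ) × (ι → ℝ) => z.1 i) μ := fun i =>
    IsGaussian.hasGaussianLaw_id.map_fun ((ContinuousLinearMap.proj (R := ℝ)
      (φ := fun _ : ι => ℝ) i).comp (ContinuousLinearMap.fst ℝ (ι → ℝ) (ι → ℝ)))
  have g2 : ∀ i, HasGaussianLaw (fun z : (ι → ℝ) × (ι → ℝ) => z.2 i) μ := fun i =>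
    IsGaussian.hasGaussianLaw_id.map_fun ((ContinuousLinearMap.proj (R := ℝ)
      (φ := fun _ : ι => ℝ) i).comp (ContinuousLinearMap.snd ℝ (ι → ℝ) (ι → ℝ)))
  have gUX : ∀ i, HasGaussianLaw (fun z : (ι → ℝ) × (ι → ℝ) => (iU θ z i, iX θ z)) μ := by
    intro i
    let F := ContinuousLinearMap.fst ℝ (ι → ℝ) (ι → ℝ)
    let S := ContinuousLinearMap.snd ℝ (ι → ℝ) (ι → ℝ)
    let Q : (ι → ℝ) →L[ℝ] ℝ := ContinuousLinearMap.proj (R := ℝ) (φ := fun _ : ι => ℝ) i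
    let A : ((ι → ℝ) × (ι → ℝ)) →L[ℝ] (ℝ × (ι → ℝ)) :=
      (Q.comp (-Real.sin θ • S + Real.cos θ • F)).prod (Real.cos θ • S + Real.sin θ • F)
    have h := (IsGaussian.hasGaussianLaw_id (μ := μ)).map_fun A
    have e : (fun z : (ι → ℝ) × (ι → ℝ) => (iU θ z i, iX θ z)) = fun z => A (id z) := by
      funext z
      refine Prod.ext ?_ ?_
      · simp [A, Q, S, F, iU]
      · funext j
        simp [A, S, F, iX]
    rw [e]; exact h
  have hU0 : ∀ i, ∫ z, iU θ z i ∂μ = 0 := by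
    intro i
    unfold iU
    rw [integral_add ((g2 i).integrable.const_mul _) ((g1 i).integrable.const_mul _),
      integral_const_mul, integral_const_mul, m1, m2]
    simp
  have hcov : ∀ i j, cov[fun z => iU θ z i, fun z => iX θ z j; μ] =
      Real.sin θ * Real.cos θ * (C₁ i j - C₂ i j) := by
    intro i j
    unfold iU iX
    have L1 := fun i => (g1 i).memLp_two
    have L2 := fun i => (g2 i).memLp_two
    have fl : ∀ {X Y Z : (ι → ℝ) × (ι → ℝ) → ℝ}, MemLp X 2 μ → MemLp Y 2 μ → MemLp Z 2 μ →
        cov[fun z => X z + Y z, Z; μ] = cov[X, Z; μ] + cov[Y, Z; μ] :=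
      fun hX hY hZ => covariance_add_left hX hY hZ
    have fr : ∀ {X Y Z : (ι → ℝ) × (ι → ℝ) → ℝ}, MemLp X 2 μ → MemLp Y 2 μ → MemLp Z 2 μ →
        cov[X, fun z => Y z + Z z; μ] = cov[X, Y; μ] + cov[X, Z; μ] :=
      fun hX hY hZ => covariance_add_right hX hY hZ
    have L3 : MemLp (fun z : (ι → ℝ) × (ι → ℝ) =>
        Real.cos θ * z.2 j + Real.sin θ * z.1 j) 2 μ :=
      ((L2 j).const_mul _).add ((L1 j).const_mul _)
    rw [fl ((L2 i).const_mul _) ((L1 i).const_mul _)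
      L3,
      fr ((L2 i).const_mul _) ((L2 j).const_mul _) ((L1 j).const_mul _),
      fr ((L1 i).const_mul _) ((L2 j).const_mul _) ((L1 j).const_mul _)]
    simp only [covariance_const_mul_left, covariance_const_mul_right]
    rw [h11, h22, h12, covariance_comm, h12]
    ring
  have hTb : ∀ x : ι → ℝ, ‖x - m‖ ≤ 1 * ‖x‖ + ‖m‖ := by
    intro x; rw [one_mul]; exact norm_sub_le _ _
  have bG : ∀ i, ExpB (fun x : ι → ℝ => lH p (x - m) * lW p i (x - m)) := fun i =>
    ((lH_expB hp0).mul (lW_expB p i)).comp (fun x => x - m) 1 ‖m‖ hTb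
  have bD : ∀ i j, ExpB (fun x : ι → ℝ => lD p i j (x - m)) := fun i j =>
    (lD_expB hp0 i j).comp (fun x => x - m) 1 ‖m‖ hTb
  have hst : ∀ i, ∫ z, iU θ z i * (lH p (iX θ z - m) * lW p i (iX θ z - m)) ∂μ =
      ∑ j, (Real.sin θ * Real.cos θ * (C₁ i j - C₂ i j)) * ∫ z, lD p i j (iX θ z - m) ∂μ := by
    intro i
    have := stein_vec (fun z => iU θ z i) (fun z => iX θ z) (gUX i) (hU0 i)
      (fun x => lH p (x - m) * lW p i (x - m)) (fun j x => lD p i j (x - m))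
      (by fun_prop) (fun j => by fun_prop) (bG i) (bD i) ?_
    · rw [this]
      exact Finset.sum_congr rfl fun j _ => by rw [hcov]
    · intro x c s
      refine (lG_deriv hp0 i (fun s => x + s • c - m) c s ?_).congr_deriv ?_
      · intro j
        have := (((hasDerivAt_id s).mul_const (c j)).const_add (x j)).sub_const (m j)
        simpa using this
      · unfold lD
        rw [Finset.mul_sum]
        have h2 : p * c i = ∑ j, p * ((if j = i then 1 else 0) * c j) := by simp
        rw [h2, ← Finset.sum_add_distrib, Finset.mul_sum]
        exact Finset.sum_congr rfl fun j _ => by ring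
  have iG : ∀ i, Integrable (fun z => lH p (iX θ z - m) * lW p i (iX θ z - m)) μ := fun i =>
    ((bG i).comp (iX θ) 2 0 (iX_norm θ)).integrable (by fun_prop) μ
  have iD : ∀ i j, Integrable (fun z => lD p i j (iX θ z - m)) μ := fun i j =>
    ((bD i j).comp (iX θ) 2 0 (iX_norm θ)).integrable (by fun_prop) μ
  have bU : ∀ i, ExpB (fun z : (ι → ℝ) × (ι → ℝ) => iU θ z i) := fun i =>
    ((ExpB.const 2).mul ExpB.norm).mono fun z => iU_bd θ z i
  have iUG : ∀ i, Integrable (fun z => iU θ z i * (lH p (iX θ z - m) * lW p i (iX θ z - m))) μ :=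
    fun i => ((bU i).mul ((bG i).comp (iX θ) 2 0 (iX_norm θ))).integrable (by fun_prop) μ
  set k : ℝ := Real.sin θ * Real.cos θ with hk
  have hk0 : 0 ≤ k := mul_nonneg hs hc
  have e1 : ∀ z, lH p (iX θ z - m) * ∑ j, lW p j (iX θ z - m) *
        (iU θ z j - k * (C₁ j j - C₂ j j)) =
      ∑ i, (iU θ z i * (lH p (iX θ z - m) * lW p i (iX θ z - m)) -
        k * (C₁ i i - C₂ i i) * (lH p (iX θ z - m) * lW p i (iX θ z - m))) := by
    intro z
    rw [Finset.mul_sum]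
    exact Finset.sum_congr rfl fun j _ => by ring
  have e2 : ∫ z, ∑ i, (iU θ z i * (lH p (iX θ z - m) * lW p i (iX θ z - m)) -
        k * (C₁ i i - C₂ i i) * (lH p (iX θ z - m) * lW p i (iX θ z - m))) ∂μ =
      ∫ z, k * ∑ i, (∑ j, (C₁ i j - C₂ i j) * lD p i j (iX θ z - m) -
        (C₁ i i - C₂ i i) * (lH p (iX θ z - m) * lW p i (iX θ z - m))) ∂μ := by
    have q1 : ∀ i, Integrable (fun z => iU θ z i * (lH p (iX θ z - m) * lW p i (iX θ z - m)) -
        k * (C₁ i i - C₂ i i) * (lH p (iX θ z - m) * lW p i (iX θ z - m))) μ := fun i =>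
      (iUG i).sub ((iG i).const_mul _)
    have q2 : ∀ i, Integrable (fun z => ∑ j, (C₁ i j - C₂ i j) * lD p i j (iX θ z - m) -
        (C₁ i i - C₂ i i) * (lH p (iX θ z - m) * lW p i (iX θ z - m))) μ := fun i =>
      (integrable_finsetSum _ fun j _ => (iD i j).const_mul _).sub ((iG i).const_mul _)
    rw [integral_finsetSum _ fun i _ => q1 i, integral_const_mul,
      integral_finsetSum _ fun i _ => q2 i, Finset.mul_sum]
    refine Finset.sum_congr rfl fun i _ => ?_
    rw [integral_sub (iUG i) ((iG i).const_mul _), integral_sub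
      (integrable_finsetSum _ fun j _ => (iD i j).const_mul _) ((iG i).const_mul _), hst,
      integral_finsetSum _ fun j _ => (iD i j).const_mul _]
    simp_rw [integral_const_mul]
    rw [mul_sub k (∑ j, _) _, Finset.mul_sum]
    congr 1
    · exact Finset.sum_congr rfl fun j _ => by ring
    · ring
  simp_rw [e1]
  rw [e2]
  refine integral_nonneg fun z => mul_nonneg hk0 ?_
  exact lD_quad hp (fun i j => C₁ i j - C₂ i j) (fun i j => by linarith [hC i j]) _

lemma interp_ineq [Nonempty ι] {p : ℝ} (hp : 1 ≤ p) (μ : Measure ((ι → ℝ) × (ι → ℝ)))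
    [IsGaussian μ] (C₁ C₂ : ι → ι → ℝ)
    (m1 : ∀ i, ∫ z, z.1 i ∂μ = 0) (m2 : ∀ i, ∫ z, z.2 i ∂μ = 0)
    (h11 : ∀ i j, cov[fun z => z.1 i, fun z => z.1 j; μ] = C₁ i j)
    (h22 : ∀ i j, cov[fun z => z.2 i, fun z => z.2 j; μ] = C₂ i j)
    (h12 : ∀ i j, cov[fun z => z.1 i, fun z => z.2 j; μ] = 0)
    (hC : ∀ i j, C₂ i i + C₂ j j - 2 * C₂ i j ≤ C₁ i i + C₁ j j - 2 * C₁ i j) :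
    ∫ z, lH p (fun i => z.2 i - C₂ i i / 2) ∂μ ≤ ∫ z, lH p (fun i => z.1 i - C₁ i i / 2) ∂μ := by
  have hp0 : 0 < p := by linarith
  have hd := phi_deriv hp0 μ (fun i => C₁ i i) (fun i => C₂ i i)
  have hmono : MonotoneOn
      (fun θ => ∫ z, lH p (iX θ z - iM (fun i => C₁ i i) (fun i => C₂ i i) θ) ∂μ)
      (Set.Icc 0 (Real.pi / 2)) := by
    refine monotoneOn_of_deriv_nonneg (convex_Icc _ _)
      (fun θ _ => (hd θ).continuousAt.continuousWithinAt)
      (fun θ _ => (hd θ).differentiableAt.differentiableWithinAt) fun θ hθ => ?_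
    rw [interior_Icc] at hθ
    rw [(hd θ).deriv]
    exact phi_deriv_nonneg hp μ C₁ C₂ m1 m2 h11 h22 h12 hC θ
      (Real.sin_nonneg_of_nonneg_of_le_pi hθ.1.le (by linarith [hθ.2, Real.pi_pos]))
      (Real.cos_nonneg_of_neg_pi_div_two_le_of_le (by linarith [hθ.1, Real.pi_pos]) hθ.2.le)
  have hpi : 0 ≤ Real.pi / 2 := by positivity
  have := hmono (Set.left_mem_Icc.2 hpi) (Set.right_mem_Icc.2 hpi) hpi
  have a : ∀ z : (ι → ℝ) × (ι → ℝ), iX 0 z - iM (fun i => C₁ i i) (fun i => C₂ i i) 0 =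
      fun i => z.2 i - C₂ i i / 2 := by
    intro z; funext i; simp [iX, iM]
  have b : ∀ z : (ι → ℝ) × (ι → ℝ), iX (Real.pi / 2) z -
      iM (fun i => C₁ i i) (fun i => C₂ i i) (Real.pi / 2) = fun i => z.1 i - C₁ i i / 2 := by
    intro z; funext i; simp [iX, iM]
  simpa only [a, b] using this

end Interp

section Field
variable {d : ℕ} {Ω : Type*} [MeasurableSpace Ω] {P : Measure Ω} [IsProbabilityMeasure P]
  {W : Ω → Idx d → ℝ}

lemma field_gauss (hG : IsCenteredGaussianField P W) {ι : Type*} [Fintype ι] (t : ι → Idx d) :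
    IsGaussian (P.map (fun ω i => W ω (t i))) := by
  classical
  refine isGaussian_of_map_eq_gaussianReal fun L => ?_
  let e := Fintype.equivFin ι
  obtain ⟨v, hv⟩ := hG.2 (Fintype.card ι)
    (fun k => L (fun j => if e.symm k = j then 1 else 0)) (fun k => t (e.symm k))
  refine ⟨0, v, ?_⟩
  have hmeas : Measurable (fun ω (i : ι) => W ω (t i)) :=
    measurable_pi_lambda _ fun i => hG.1 (t i)
  rw [Measure.map_map L.continuous.measurable hmeas, ← hv]
  congr 1
  funext ω
  have h := LinearMap.pi_apply_eq_sum_univ (L : (ι → ℝ) →ₗ[ℝ] ℝ) (fun i => W ω (t i))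
  refine h.trans ?_
  rw [← e.symm.sum_comp]
  refine Finset.sum_congr rfl fun k _ => ?_
  simp [mul_comm]

lemma field_law (hG : IsCenteredGaussianField P W) (t : Idx d) :
    ∃ v : ℝ≥0, P.map (fun ω => W ω t) = gaussianReal 0 v := by
  obtain ⟨v, hv⟩ := hG.2 1 (fun _ => 1) (fun _ => t)
  exact ⟨v, by simpa using hv⟩

lemma field_memLp (hG : IsCenteredGaussianField P W) (t : Idx d) :
    MemLp (fun ω => W ω t) 2 P := by
  obtain ⟨v, hv⟩ := field_law hG t
  have : HasGaussianLaw (fun ω => W ω t) P := ⟨by rw [hv]; infer_instance⟩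
  exact this.memLp_two

lemma field_mean (hG : IsCenteredGaussianField P W) (t : Idx d) : ∫ ω, W ω t ∂P = 0 := by
  obtain ⟨v, hv⟩ := field_law hG t
  have h := integral_map (hG.1 t).aemeasurable (f := fun x : ℝ => x) (μ := P)
    aestronglyMeasurable_id
  rw [← h, hv, integral_id_gaussianReal]

lemma field_cov (hG : IsCenteredGaussianField P W) (s t : Idx d) :
    cov[fun ω => W ω s, fun ω => W ω t; P] = ∫ ω, W ω s * W ω t ∂P := by
  rw [covariance_eq_sub (field_memLp hG s) (field_memLp hG t), field_mean hG]
  simp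

lemma field_vario (hG : IsCenteredGaussianField P W) (hsi : HasStationaryIncrements P W)
    (s t : Idx d) :
    ∫ ω, W ω s * W ω s ∂P + ∫ ω, W ω t * W ω t ∂P - 2 * ∫ ω, W ω s * W ω t ∂P =
      ∫ ω, (W ω (s - t)) ^ 2 ∂P := by
  have i1 : ∀ s t, Integrable (fun ω => W ω s * W ω t) P := fun s t =>
    (field_memLp hG s).integrable_mul (field_memLp hG t)
  have h := hsi t 1 (fun _ => s - t)
  have hm : Measurable (fun x : Fin 1 → ℝ => (x 0) ^ 2) := by fun_prop
  have m1 : Measurable (fun ω (_ : Fin 1) => W ω (s - t + t) - W ω t) :=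
    measurable_pi_lambda _ fun _ => (hG.1 _).sub (hG.1 _)
  have m2 : Measurable (fun ω (_ : Fin 1) => W ω (s - t)) :=
    measurable_pi_lambda _ fun _ => hG.1 _
  have a := integral_map (μ := P) m1.aemeasurable (f := fun x : Fin 1 → ℝ => (x 0) ^ 2)
    hm.aestronglyMeasurable
  have b := integral_map (μ := P) m2.aemeasurable (f := fun x : Fin 1 → ℝ => (x 0) ^ 2)
    hm.aestronglyMeasurable
  rw [← b, ← h, a, sub_add_cancel]
  have e : ∀ ω, (W ω s - W ω t) ^ 2 = W ω s * W ω s + W ω t * W ω t - 2 * (W ω s * W ω t) :=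
    fun ω => by ring
  simp only [e]
  have q : Integrable (fun ω => W ω s * W ω s + W ω t * W ω t) P := (i1 s s).add (i1 t t)
  rw [integral_sub q ((i1 s t).const_mul 2), integral_add (i1 s s) (i1 t t), integral_const_mul]

end Field

section Compare
variable {d : ℕ} {Ω : Type*} [MeasurableSpace Ω] {P : Measure Ω} [IsProbabilityMeasure P]
  {W₁ W₂ : Ω → Idx d → ℝ}

lemma field_smooth_le {ι : Type*} [Fintype ι] [Nonempty ι] {p : ℝ} (hp : 1 ≤ p)
    (hG₁ : IsCenteredGaussianField P W₁) (hG₂ : IsCenteredGaussianField P W₂)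
    (hsi₁ : HasStationaryIncrements P W₁) (hsi₂ : HasStationaryIncrements P W₂)
    (σsq₁ σsq₂ : Idx d → ℝ)
    (hv₁ : ∀ t, σsq₁ t = ∫ ω, (W₁ ω t) ^ 2 ∂P)
    (hv₂ : ∀ t, σsq₂ t = ∫ ω, (W₂ ω t) ^ 2 ∂P)
    (hσ : ∀ t, σsq₂ t ≤ σsq₁ t) (t : ι → Idx d) :
    ∫ ω, lH p (fun i => W₂ ω (t i) - σsq₂ (t i) / 2) ∂P ≤
      ∫ ω, lH p (fun i => W₁ ω (t i) - σsq₁ (t i) / 2) ∂P := by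
  have M : ∀ {W : Ω → Idx d → ℝ}, IsCenteredGaussianField P W →
      Measurable (fun ω (i : ι) => W ω (t i)) := fun hG =>
    measurable_pi_lambda _ fun i => hG.1 (t i)
  have N1 := field_gauss hG₁ t
  have N2 := field_gauss hG₂ t
  set ν₁ := P.map (fun ω (i : ι) => W₁ ω (t i)) with hν₁
  set ν₂ := P.map (fun ω (i : ι) => W₂ ω (t i)) with hν₂
  have pm : ∀ i, Measurable (fun x : ι → ℝ => x i) := fun i => measurable_pi_apply i
  have mean1 : ∀ i, ∫ x, x i ∂ν₁ = 0 := fun i => by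
    rw [hν₁, integral_map (M hG₁).aemeasurable (pm i).aestronglyMeasurable, field_mean hG₁]
  have mean2 : ∀ i, ∫ x, x i ∂ν₂ = 0 := fun i => by
    rw [hν₂, integral_map (M hG₂).aemeasurable (pm i).aestronglyMeasurable, field_mean hG₂]
  have cov1 : ∀ i j, cov[fun x => x i, fun x => x j; ν₁] = ∫ ω, W₁ ω (t i) * W₁ ω (t j) ∂P :=
    fun i j => by
      rw [hν₁, covariance_map_fun (pm i).aestronglyMeasurable (pm j).aestronglyMeasurable
        (M hG₁).aemeasurable, field_cov hG₁]
  have cov2 : ∀ i j, cov[fun x => x i, fun x => x j; ν₂] = ∫ ω, W₂ ω (t i) * W₂ ω (t j) ∂P :=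
    fun i j => by
      rw [hν₂, covariance_map_fun (pm i).aestronglyMeasurable (pm j).aestronglyMeasurable
        (M hG₂).aemeasurable, field_cov hG₂]
  have L1 : ∀ i, MemLp (fun x : ι → ℝ => x i) 2 ν₁ := fun i => by
    rw [hν₁, memLp_map_measure_iff (pm i).aestronglyMeasurable (M hG₁).aemeasurable]
    exact field_memLp hG₁ (t i)
  have L2 : ∀ i, MemLp (fun x : ι → ℝ => x i) 2 ν₂ := fun i => by
    rw [hν₂, memLp_map_measure_iff (pm i).aestronglyMeasurable (M hG₂).aemeasurable]
    exact field_memLp hG₂ (t i)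
  have F1 : ∀ f : (ι → ℝ) → ℝ, ∫ z, f z.1 ∂(ν₁.prod ν₂) = ∫ x, f x ∂ν₁ := fun f => by
    rw [integral_fun_fst]; simp
  have F2 : ∀ f : (ι → ℝ) → ℝ, ∫ z, f z.2 ∂(ν₁.prod ν₂) = ∫ x, f x ∂ν₂ := fun f => by
    rw [integral_fun_snd]; simp
  have s1 : ∀ s, ∫ ω, W₁ ω s * W₁ ω s ∂P = σsq₁ s := fun s => by
    rw [hv₁]; simp only [sq]
  have s2 : ∀ s, ∫ ω, W₂ ω s * W₂ ω s ∂P = σsq₂ s := fun s => by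
    rw [hv₂]; simp only [sq]
  have key := interp_ineq hp (ν₁.prod ν₂) (fun i j => ∫ ω, W₁ ω (t i) * W₁ ω (t j) ∂P)
    (fun i j => ∫ ω, W₂ ω (t i) * W₂ ω (t j) ∂P)
    (fun i => (F1 fun x => x i).trans (mean1 i)) (fun i => (F2 fun x => x i).trans (mean2 i))
    (fun i j => by
      rw [← cov1]
      unfold covariance
      rw [F1 fun x => x i, F1 fun x => x j]
      exact F1 fun x => (x i - ∫ x, x i ∂ν₁) * (x j - ∫ x, x j ∂ν₁))
    (fun i j => by
      rw [← cov2]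
      unfold covariance
      rw [F2 fun x => x i, F2 fun x => x j]
      exact F2 fun x => (x i - ∫ x, x i ∂ν₂) * (x j - ∫ x, x j ∂ν₂))
    (fun i j => covariance_fst_snd_prod (L1 i) (L2 j))
    (fun i j => by
      rw [field_vario hG₁ hsi₁, field_vario hG₂ hsi₂, ← hv₁, ← hv₂]
      exact hσ _)
  simp only [s1, s2] at key
  have hHc := lH_cont (ι := ι) p
  have k1 : ∫ z, lH p (fun i => z.1 i - σsq₁ (t i) / 2) ∂(ν₁.prod ν₂) =
      ∫ ω, lH p (fun i => W₁ ω (t i) - σsq₁ (t i) / 2) ∂P := by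
    rw [F1 fun x => lH p (fun i => x i - σsq₁ (t i) / 2), hν₁,
      integral_map (M hG₁).aemeasurable]
    have : Continuous fun x : ι → ℝ => lH p (fun i => x i - σsq₁ (t i) / 2) := by fun_prop
    exact this.aestronglyMeasurable
  have k2 : ∫ z, lH p (fun i => z.2 i - σsq₂ (t i) / 2) ∂(ν₁.prod ν₂) =
      ∫ ω, lH p (fun i => W₂ ω (t i) - σsq₂ (t i) / 2) ∂P := by
    rw [F2 fun x => lH p (fun i => x i - σsq₂ (t i) / 2), hν₂,
      integral_map (M hG₂).aemeasurable]
    have : Continuous fun x : ι → ℝ => lH p (fun i => x i - σsq₂ (t i) / 2) := by fun_prop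
    exact this.aestronglyMeasurable
  rw [k1, k2] at key
  exact key

lemma field_lH_integrable {W : Ω → Idx d → ℝ} {ι : Type*} [Fintype ι] [Nonempty ι] {p : ℝ}
    (hp : 0 < p) (hG : IsCenteredGaussianField P W) (c : ι → ℝ) (t : ι → Idx d) :
    Integrable (fun ω => lH p (fun i => W ω (t i) - c i)) P := by
  have N1 := field_gauss hG t
  have M : Measurable (fun ω (i : ι) => W ω (t i)) :=
    measurable_pi_lambda _ fun i => hG.1 (t i)
  have hHc := lH_cont (ι := ι) p
  have hc : Continuous fun x : ι → ℝ => lH p (x - c) := by fun_prop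
  have hb : ExpB (fun x : ι → ℝ => lH p (x - c)) :=
    (lH_expB hp).comp (fun x => x - c) 1 ‖c‖ fun x => by rw [one_mul]; exact norm_sub_le _ _
  have := hb.integrable hc (P.map (fun ω (i : ι) => W ω (t i)))
  exact this.comp_measurable M

lemma lint_max_le (n : ℕ)
    (hG₁ : IsCenteredGaussianField P W₁) (hG₂ : IsCenteredGaussianField P W₂)
    (hsi₁ : HasStationaryIncrements P W₁) (hsi₂ : HasStationaryIncrements P W₂)
    (σsq₁ σsq₂ : Idx d → ℝ)
    (hv₁ : ∀ t, σsq₁ t = ∫ ω, (W₁ ω t) ^ 2 ∂P)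
    (hv₂ : ∀ t, σsq₂ t = ∫ ω, (W₂ ω t) ^ 2 ∂P)
    (hσ : ∀ t, σsq₂ t ≤ σsq₁ t) :
    ∫⁻ ω, ⨆ t ∈ cube d n, ENNReal.ofReal (Real.exp (W₂ ω t - σsq₂ t / 2)) ∂P ≤
      ∫⁻ ω, ⨆ t ∈ cube d n, ENNReal.ofReal (Real.exp (W₁ ω t - σsq₁ t / 2)) ∂P := by
  have hfin : (cube d n).Finite := by
    refine (Set.finite_Icc (0 : Idx d) (fun _ => (n : ℤ))).subset fun t ht => ?_
    exact ⟨fun j => (ht j).1, fun j => (ht j).2⟩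
  let ι := {t // t ∈ cube d n}
  haveI : Fintype ι := hfin.fintype
  haveI : Nonempty ι := ⟨⟨0, fun j => ⟨le_refl _, Int.natCast_nonneg n⟩⟩⟩
  have step : ∀ k : ℕ,
      ∫⁻ ω, ⨆ t ∈ cube d n, ENNReal.ofReal (Real.exp (W₂ ω t - σsq₂ t / 2)) ∂P ≤
      ENNReal.ofReal (Real.exp (Real.log (Fintype.card ι) / ((k : ℝ) + 1))) *
      ∫⁻ ω, ⨆ t ∈ cube d n, ENNReal.ofReal (Real.exp (W₁ ω t - σsq₁ t / 2)) ∂P := by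
    intro k
    set p : ℝ := (k : ℝ) + 1 with hpk
    have hp : 1 ≤ p := by rw [hpk]; linarith [Nat.cast_nonneg (α := ℝ) k]
    have hp0 : 0 < p := by linarith
    have I1 := field_lH_integrable hp0 hG₁ (fun i : ι => σsq₁ i.1 / 2) (fun i : ι => i.1)
    have I2 := field_lH_integrable hp0 hG₂ (fun i : ι => σsq₂ i.1 / 2) (fun i : ι => i.1)
    calc _ ≤ ∫⁻ ω, ENNReal.ofReal (lH p (fun i : ι => W₂ ω i.1 - σsq₂ i.1 / 2)) ∂P := by
          refine lintegral_mono fun ω => iSup₂_le fun t ht => ENNReal.ofReal_le_ofReal ?_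
          exact exp_le_lH hp0 (fun i : ι => W₂ ω i.1 - σsq₂ i.1 / 2) ⟨t, ht⟩
      _ = ENNReal.ofReal (∫ ω, lH p (fun i : ι => W₂ ω i.1 - σsq₂ i.1 / 2) ∂P) :=
          (ofReal_integral_eq_lintegral_ofReal I2 (ae_of_all _ fun ω => (lH_pos _ _).le)).symm
      _ ≤ ENNReal.ofReal (∫ ω, lH p (fun i : ι => W₁ ω i.1 - σsq₁ i.1 / 2) ∂P) :=
          ENNReal.ofReal_le_ofReal
            (field_smooth_le hp hG₁ hG₂ hsi₁ hsi₂ σsq₁ σsq₂ hv₁ hv₂ hσ (fun i : ι => i.1))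
      _ = ∫⁻ ω, ENNReal.ofReal (lH p (fun i : ι => W₁ ω i.1 - σsq₁ i.1 / 2)) ∂P :=
          ofReal_integral_eq_lintegral_ofReal I1 (ae_of_all _ fun ω => (lH_pos _ _).le)
      _ ≤ ∫⁻ ω, ENNReal.ofReal (Real.exp (Real.log (Fintype.card ι) / p)) *
            ⨆ t ∈ cube d n, ENNReal.ofReal (Real.exp (W₁ ω t - σsq₁ t / 2)) ∂P := by
          refine lintegral_mono fun ω => ?_
          obtain ⟨i₀, hi₀⟩ := Finite.exists_max (fun i : ι => W₁ ω i.1 - σsq₁ i.1 / 2)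
          have := lH_le_of hp0 (fun i : ι => W₁ ω i.1 - σsq₁ i.1 / 2) _ hi₀
          refine (ENNReal.ofReal_le_ofReal this).trans ?_
          rw [ENNReal.ofReal_mul (Real.exp_nonneg _)]
          refine mul_le_mul_right ?_ _
          exact le_iSup₂ (f := fun t (_ : t ∈ cube d n) =>
            ENNReal.ofReal (Real.exp (W₁ ω t - σsq₁ t / 2))) i₀.1 i₀.2
      _ = _ := lintegral_const_mul' _ _ ENNReal.ofReal_ne_top
  have hlim : Tendsto (fun k : ℕ =>
      ENNReal.ofReal (Real.exp (Real.log (Fintype.card ι) / ((k : ℝ) + 1))) *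
      ∫⁻ ω, ⨆ t ∈ cube d n, ENNReal.ofReal (Real.exp (W₁ ω t - σsq₁ t / 2)) ∂P) atTop
      (nhds (1 * ∫⁻ ω, ⨆ t ∈ cube d n,
        ENNReal.ofReal (Real.exp (W₁ ω t - σsq₁ t / 2)) ∂P)) := by
    refine ENNReal.Tendsto.mul_const ?_ (Or.inl one_ne_zero)
    have h1 : Tendsto (fun k : ℕ => Real.log (Fintype.card ι) / ((k : ℝ) + 1)) atTop (nhds 0) :=
      tendsto_const_nhds.div_atTop
        (tendsto_natCast_atTop_atTop.atTop_add tendsto_const_nhds)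
    have h2 := ENNReal.tendsto_ofReal ((Real.continuous_exp.tendsto 0).comp h1)
    simpa using h2
  rw [one_mul] at hlim
  exact ge_of_tendsto' hlim step

end Compare

/-- Let `W₁, W₂` be centered Gaussian fields on `ℤ^d` with `Wᵢ(0)=0`
a.s., stationary increments and variance functions `σᵢ²`.  If the extremal indices
`θᵢ = lim n^{-d} E[max_{t∈{0,…,n}^d} exp(Wᵢ(t) - σᵢ²(t)/2)]` exist and `σ₁ ≥ σ₂`
pointwise, then `θ₁ ≥ θ₂`. -/
theorem stmt12 {d : ℕ} (hd : 0 < d) {Ω : Type*} [MeasurableSpace Ω] (P : Measure Ω)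
    [IsProbabilityMeasure P] (W₁ W₂ : Ω → Idx d → ℝ)
    (hG₁ : IsCenteredGaussianField P W₁) (hG₂ : IsCenteredGaussianField P W₂)
    (h0₁ : ∀ᵐ ω ∂P, W₁ ω 0 = 0) (h0₂ : ∀ᵐ ω ∂P, W₂ ω 0 = 0)
    (hsi₁ : HasStationaryIncrements P W₁) (hsi₂ : HasStationaryIncrements P W₂)
    (σsq₁ σsq₂ : Idx d → ℝ)
    (hv₁ : ∀ t, σsq₁ t = ∫ ω, (W₁ ω t) ^ 2 ∂P)
    (hv₂ : ∀ t, σsq₂ t = ∫ ω, (W₂ ω t) ^ 2 ∂P)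
    (θ₁ θ₂ : ℝ≥0∞)
    (hθ₁ : Tendsto
      (fun n : ℕ =>
        (∫⁻ ω, ⨆ t ∈ cube d n, ENNReal.ofReal (Real.exp (W₁ ω t - σsq₁ t / 2)) ∂P) /
          (n : ℝ≥0∞) ^ d) atTop (nhds θ₁))
    (hθ₂ : Tendsto
      (fun n : ℕ =>
        (∫⁻ ω, ⨆ t ∈ cube d n, ENNReal.ofReal (Real.exp (W₂ ω t - σsq₂ t / 2)) ∂P) /
          (n : ℝ≥0∞) ^ d) atTop (nhds θ₂))
    (hσ : ∀ t, σsq₂ t ≤ σsq₁ t) :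
    θ₂ ≤ θ₁ := by
  exact le_of_tendsto_of_tendsto' hθ₂ hθ₁ fun n => ENNReal.div_le_div_right
    (lint_max_le n hG₁ hG₂ hsi₁ hsi₂ σsq₁ σsq₂ hv₁ hv₂ hσ) _
end

section
/- Let Z be a Brown–Resnick stationary random field with values in E satisfying E[Z(t)] = 1 for all t ∈ ℤ^d and max_{t∈ℤ^d} Z(t) > 0 almost surely. Let F : E → [0,∞] be a measurable map that is both shift-invariant and 0-homogeneous. Then E[F(Z)] = 0 if and only if E[Z(0) F(Z)] = 0; and if additionally F ≤ 1, then E[F(Z)] = 1 if and only if E[Z(0) F(Z)] = 1. (Here E[Z(0) F(Z)] equals E[F(Θ)] for the spectral tail field Θ of Z.) -/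
open MeasureTheory ENNReal Filter
open scoped NNReal ENNReal

/-- `F` is shift-invariant: `F (B^h f) = F f`. -/
def ShiftInv {d : ℕ} (F : Fld d → ℝ≥0∞) : Prop :=
  ∀ (h : Idx d) (f : Fld d), F (shift h f) = F f

theorem zero_iff_aux {d : ℕ} {Ω : Type*} [MeasurableSpace Ω] (P : Measure Ω)
    (Z : Ω → Fld d) (hZ : IsBRS P Z)
    (hZpos : ∀ᵐ ω ∂P, ∃ t, 0 < Z ω t)
    (F : Fld d → ℝ≥0∞) (hFmeas : Measurable F) (hFinv : ShiftInv F) (hFhom : Homog0 F) :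
    (∫⁻ ω, F (Z ω) ∂P) = 0 ↔ (∫⁻ ω, (Z ω 0 : ℝ≥0∞) * F (Z ω) ∂P) = 0 := by
  have hm : Measurable fun ω => F (Z ω) := hFmeas.comp hZ.meas
  have hz : ∀ t, Measurable fun ω => (Z ω t : ℝ≥0∞) := fun t =>
    ((measurable_pi_apply t).comp hZ.meas).coe_nnreal_ennreal
  have hzm : ∀ t, Measurable fun ω => (Z ω t : ℝ≥0∞) * F (Z ω) := fun t => (hz t).mul hm
  constructor
  · intro h
    rw [lintegral_eq_zero_iff hm] at h
    rw [lintegral_eq_zero_iff (hzm 0)]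
    filter_upwards [h] with ω hω
    simp only [Pi.zero_apply] at hω ⊢
    rw [hω, mul_zero]
  · intro h
    have key : ∀ t, ∀ᵐ ω ∂P, (Z ω t : ℝ≥0∞) * F (Z ω) = 0 := by
      intro t
      have h1 := hZ.tilt_shift t F hFmeas hFhom
      simp only [hFinv t] at h1
      rw [h, lintegral_eq_zero_iff (hzm t)] at h1
      exact h1
    rw [lintegral_eq_zero_iff hm]
    filter_upwards [ae_all_iff.2 key, hZpos] with ω hω hp
    obtain ⟨t, ht⟩ := hp
    rcases mul_eq_zero.1 (hω t) with h0 | h0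
    · exact absurd (ENNReal.coe_eq_zero.1 h0) ht.ne'
    · exact h0

theorem one_iff_aux {Ω : Type*} [MeasurableSpace Ω] (P : Measure Ω) (w G : Ω → ℝ≥0∞)
    (hw : Measurable w) (hG : Measurable G) (h1 : ∫⁻ ω, w ω ∂P = 1) (hG1 : ∀ ω, G ω ≤ 1) :
    (∫⁻ ω, w ω * G ω ∂P) = 1 ↔ (∫⁻ ω, w ω * (1 - G ω) ∂P) = 0 := by
  have hs : (∫⁻ ω, w ω * G ω ∂P) + (∫⁻ ω, w ω * (1 - G ω) ∂P) = 1 := by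
    have hwG : Measurable fun ω => w ω * G ω := hw.mul hG
    rw [← lintegral_add_left hwG]
    refine Eq.trans (lintegral_congr fun ω => ?_) h1
    rw [← mul_add, add_tsub_cancel_of_le (hG1 ω), mul_one]
  constructor
  · intro h
    rw [h] at hs
    exact (ENNReal.add_right_inj ENNReal.one_ne_top).1 (hs.trans (add_zero 1).symm)
  · intro h
    rwa [h, add_zero] at hs

/-- Let `Z` be Brown–Resnick stationary with `E[Z(t)] = 1` and
`max_t Z(t) > 0` a.s., and let `F : E → [0,∞]` be measurable, shift-invariant and
0-homogeneous.  Then `E[F(Z)] = 0` iff `E[Z(0) F(Z)] = 0` (the latter being `E[F(Θ)]`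
for the spectral tail field `Θ`); and if moreover `F ≤ 1`, then `E[F(Z)] = 1` iff
`E[Z(0) F(Z)] = 1`. -/
theorem stmt13 {d : ℕ} (hd : 0 < d) {Ω : Type*} [MeasurableSpace Ω] (P : Measure Ω)
    [IsProbabilityMeasure P] (Z : Ω → Fld d) (hZ : IsBRS P Z)
    (hZpos : ∀ᵐ ω ∂P, ∃ t, 0 < Z ω t)
    (F : Fld d → ℝ≥0∞) (hFmeas : Measurable F) (hFinv : ShiftInv F) (hFhom : Homog0 F) :
    ((∫⁻ ω, F (Z ω) ∂P) = 0 ↔ (∫⁻ ω, (Z ω 0 : ℝ≥0∞) * F (Z ω) ∂P) = 0) ∧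
    ((∀ f, F f ≤ 1) →
      ((∫⁻ ω, F (Z ω) ∂P) = 1 ↔ (∫⁻ ω, (Z ω 0 : ℝ≥0∞) * F (Z ω) ∂P) = 1)) := by
  refine ⟨zero_iff_aux P Z hZ hZpos F hFmeas hFinv hFhom, fun hF1 => ?_⟩
  have hm : Measurable fun ω => F (Z ω) := hFmeas.comp hZ.meas
  have hz : Measurable fun ω => (Z ω 0 : ℝ≥0∞) :=
    ((measurable_pi_apply 0).comp hZ.meas).coe_nnreal_ennreal
  have a := one_iff_aux P (fun _ => 1) (fun ω => F (Z ω)) measurable_const hm (by simp)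
    (fun ω => hF1 _)
  have b := one_iff_aux P (fun ω => (Z ω 0 : ℝ≥0∞)) (fun ω => F (Z ω)) hz hm (hZ.mean_one 0)
    (fun ω => hF1 _)
  have c := zero_iff_aux P Z hZ hZpos (fun f => 1 - F f) (measurable_const.sub hFmeas)
    (fun h f => by simp only [hFinv h f]) (fun c hc f => by simp only [hFhom c hc f])
  simp only [one_mul] at a
  exact a.trans (c.trans b.symm)
end

section
/- Let Z be a measurable random field with values in E such that E[Z(t)] ∈ (0,∞) for all t ∈ ℤ^d, and set q = P(max_{t∈ℤ^d} Z(t) > 0) (which is positive). Let Z* be a random field with values in E whose law is the conditional law of the field q·Z given the event {max_{t∈ℤ^d} Z(t) > 0}. Then max_{t∈ℤ^d} Z*(t) > 0 almost surely, and for every n ≥ 1, t₁,…,t_n ∈ ℤ^d and x₁,…,x_n ∈ (0,∞): E[max_{1≤i≤n} Z*(t_i)/x_i] = E[max_{1≤i≤n} Z(t_i)/x_i]. In particular Z* is a spectral field for the same max-stable random field as Z. -/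
open MeasureTheory ENNReal Filter
open scoped NNReal ENNReal

/-- Let `Z` be measurable with `E[Z(t)] ∈ (0,∞)` for all `t`, set
`q = P(max_t Z(t) > 0)`, and let `Z*` have the conditional law of the field `q·Z` given
`{max_t Z(t) > 0}`.  Then `q > 0`, `max_t Z*(t) > 0` a.s., and
`E[max_i Z*(tᵢ)/xᵢ] = E[max_i Z(tᵢ)/xᵢ]` for all finite collections `tᵢ`, `xᵢ > 0`;
in particular `Z*` is a spectral field for the same max-stable field as `Z`. -/
theorem stmt15 {d : ℕ} (hd : 0 < d) {Ω Ω' : Type*} [MeasurableSpace Ω] [MeasurableSpace Ω']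
    (P : Measure Ω) [IsProbabilityMeasure P] (Q : Measure Ω') [IsProbabilityMeasure Q]
    (Z : Ω → Fld d) (hZmeas : Measurable Z)
    (hmean : ∀ t : Idx d, 0 < ∫⁻ ω, (Z ω t : ℝ≥0∞) ∂P ∧ (∫⁻ ω, (Z ω t : ℝ≥0∞) ∂P) < ∞)
    (Zs : Ω' → Fld d) (hZsmeas : Measurable Zs)
    (hlaw : ∀ A : Set (Fld d), MeasurableSet A →
      Q (Zs ⁻¹' A) =
        P ({ω | ∃ t, 0 < Z ω t} ∩
            {ω | (fun t => (P {ω' | ∃ s, 0 < Z ω' s}).toNNReal * Z ω t) ∈ A}) /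
          P {ω | ∃ t, 0 < Z ω t}) :
    0 < P {ω | ∃ t, 0 < Z ω t} ∧
    (∀ᵐ ω' ∂Q, ∃ t, 0 < Zs ω' t) ∧
    (∀ (n : ℕ), 0 < n → ∀ (t : Fin n → Idx d) (x : Fin n → ℝ≥0), (∀ i, 0 < x i) →
      ∫⁻ ω', ⨆ i, (Zs ω' (t i) : ℝ≥0∞) / (x i : ℝ≥0∞) ∂Q =
        ∫⁻ ω, ⨆ i, (Z ω (t i) : ℝ≥0∞) / (x i : ℝ≥0∞) ∂P) := by
  classical
  have hEmeas : MeasurableSet {z : Fld d | ∃ t, 0 < z t} := by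
    have : {z : Fld d | ∃ t, 0 < z t} = ⋃ t, {z : Fld d | 0 < z t} := by
      ext z; simp
    rw [this]
    exact MeasurableSet.iUnion fun t => measurableSet_lt measurable_const (measurable_pi_apply t)
  have hSmeas : MeasurableSet {ω | ∃ t, 0 < Z ω t} := hZmeas hEmeas
  have hq : 0 < P {ω | ∃ t, 0 < Z ω t} := by
    rw [pos_iff_ne_zero]
    intro h0
    have h1 := (hmean 0).1
    have h2 : ∫⁻ ω, (Z ω 0 : ℝ≥0∞) ∂P = 0 := by
      rw [lintegral_eq_zero_iff (by fun_prop)]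
      have h3 : ∀ᵐ ω ∂P, ¬ ∃ t, 0 < Z ω t := by
        rw [ae_iff]; simpa only [not_not] using h0
      filter_upwards [h3] with ω hω
      push Not at hω
      simpa using hω 0
    exact h1.ne' h2
  have hqt : P {ω | ∃ t, 0 < Z ω t} ≠ ∞ := measure_ne_top _ _
  set S := {ω | ∃ t, 0 < Z ω t} with hS
  set c : ℝ≥0 := (P S).toNNReal with hc
  have hcq : (c : ℝ≥0∞) = P S := ENNReal.coe_toNNReal hqt
  have hcpos : 0 < c := ENNReal.toNNReal_pos hq.ne' hqt
  have hgm : Measurable (fun ω => (fun t => c * Z ω t : Fld d)) := by fun_prop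
  have hmap : Q.map Zs = (P S)⁻¹ • (P.restrict S).map (fun ω => (fun t => c * Z ω t : Fld d)) := by
    ext A hA
    rw [Measure.map_apply hZsmeas hA, hlaw A hA, Measure.smul_apply, Measure.map_apply hgm hA,
      Measure.restrict_apply (hgm hA), smul_eq_mul, ENNReal.div_eq_inv_mul, Set.inter_comm]
    rfl
  refine ⟨hq, ?_, ?_⟩
  · have h1 : ∀ᵐ z ∂(Q.map Zs), ∃ t, 0 < z t := by
      rw [hmap]
      apply Measure.ae_smul_measure
      rw [ae_map_iff hgm.aemeasurable hEmeas]
      filter_upwards [ae_restrict_mem hSmeas] with ω hω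
      obtain ⟨t, ht⟩ := hω
      exact ⟨t, mul_pos hcpos ht⟩
    exact ae_of_ae_map hZsmeas.aemeasurable h1
  · intro n hn t x hx
    have hf : Measurable (fun z : Fld d => ⨆ i, (z (t i) : ℝ≥0∞) / (x i : ℝ≥0∞)) := by
      refine Measurable.iSup fun i => ?_
      fun_prop
    have hfZ : Measurable (fun ω => ⨆ i, (Z ω (t i) : ℝ≥0∞) / (x i : ℝ≥0∞)) := hf.comp hZmeas
    have e1 := lintegral_map (μ := Q) hf hZsmeas
    rw [← e1, hmap, lintegral_smul_measure, lintegral_map hf hgm]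
    have e2 : ∀ ω, (⨆ i, ((c * Z ω (t i) : ℝ≥0) : ℝ≥0∞) / (x i : ℝ≥0∞))
        = P S * ⨆ i, (Z ω (t i) : ℝ≥0∞) / (x i : ℝ≥0∞) := by
      intro ω
      rw [ENNReal.mul_iSup]
      congr 1; ext1 i
      rw [ENNReal.coe_mul, hcq, mul_div_assoc]
    simp_rw [e2]
    rw [lintegral_const_mul _ hfZ, smul_eq_mul, ← mul_assoc,
      ENNReal.inv_mul_cancel hq.ne' hqt, one_mul]
    rw [← lintegral_indicator hSmeas]
    congr 1; ext1 ω
    by_cases hn' : ω ∈ S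
    · rw [Set.indicator_of_mem hn']
    rw [Set.indicator_of_notMem hn']
    have h0 : ∀ s, Z ω s = 0 := by
      intro s
      by_contra hs
      exact hn' ⟨s, pos_iff_ne_zero.2 hs⟩
    simp [h0]
end
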